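/- Let r ≥ 2 and let S_{2,r} = F_r/[[F_r,F_r],[F_r,F_r]] be the free metabelian group on r generators (the quotient of the free group F_r by the second term of its derived series). Let μ be the lazy simple random walk measure on S_{2,r}. Then there exists a constant C ≥ 1 such that for all n ≥ 2: exp(−C·n^{r/(r+2)}·(log n)^{2/(r+2)}) ≤ μ^{(2n)}(e) ≤ exp(−(1/C)·n^{r/(r+2)}·(log n)^{2/(r+2)}). -/

import Mathlib

open scoped Pointwise

noncomputable section

open Classical in
/-- Convolution of two real-valued functions ("measures") on a group:
`(μ ∗ ν)(g) = Σ_h μ(h) ν(h⁻¹ g)`. -/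
noncomputable def conv {G : Type*} [Group G] (μ ν : G → ℝ) : G → ℝ :=
  fun g => ∑' h : G, μ h * ν (h⁻¹ * g)

open Classical in
/-- `convPow μ n` is the `n`-fold convolution power of `μ`;
`convPow μ 0` is the Dirac mass at the identity. -/
noncomputable def convPow {G : Type*} [Group G] (μ : G → ℝ) : ℕ → G → ℝ
  | 0 => fun g => if g = 1 then 1 else 0
  | n + 1 => conv μ (convPow μ n)

/-- Pushforward of a measure along a map. -/
noncomputable def pushforward {G H : Type*} (f : G → H) (μ : G → ℝ) : H → ℝ :=
  fun h => ∑' g : {g : G // f g = h}, μ g.1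

open Classical in
/-- The lazy simple random walk measure on the free group on `r` generators:
mass `1/2` at the identity and mass `1/(4r)` at each `sᵢ^{±1}`. -/
noncomputable def lazySRW (r : ℕ) : FreeGroup (Fin r) → ℝ := fun g =>
  if g = 1 then 1 / 2
  else if ∃ i : Fin r, g = FreeGroup.of i ∨ g = (FreeGroup.of i)⁻¹ then 1 / (4 * r)
  else 0

/-- The lazy simple random walk measure on the quotient `F_r / M`, i.e. the pushforward
of `lazySRW r` under the quotient map. -/
noncomputable def lazySRWQuot (r : ℕ) (M : Subgroup (FreeGroup (Fin r))) [M.Normal] :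
    FreeGroup (Fin r) ⧸ M → ℝ :=
  pushforward (QuotientGroup.mk : FreeGroup (Fin r) → FreeGroup (Fin r) ⧸ M) (lazySRW r)

/-- Iterated logarithms: `iterLog 1 x = log (1 + x)` and
`iterLog (i+1) x = log (1 + iterLog i x)`. -/
noncomputable def iterLog : ℕ → ℝ → ℝ
  | 0, x => x
  | n + 1, x => Real.log (1 + iterLog n x)

instance derivedSeriesNormal (G : Type*) [Group G] (n : ℕ) : (derivedSeries G n).Normal :=
  derivedSeries_normal G n

namespace FM

/-- The alphabet of steps. -/
abbrev S (r : ℕ) := Option (Fin r × Bool)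

/-- step weights -/
def p (r : ℕ) : S r → ℝ
  | none => 1 / 2
  | some _ => 1 / (4 * r)

/-- value of a step in the free group -/
def val {r : ℕ} : S r → FreeGroup (Fin r)
  | none => 1
  | some (i, true) => FreeGroup.of i
  | some (i, false) => (FreeGroup.of i)⁻¹

/-- inverse step -/
def inv {r : ℕ} : S r → S r
  | none => none
  | some (i, b) => some (i, !b)

theorem inv_inv {r : ℕ} (a : S r) : inv (inv a) = a := by
  rcases a with _ | ⟨i, b⟩ <;> simp [inv]

/-- inverse step as an equivalence -/
def invE (r : ℕ) : S r ≃ S r := ⟨inv, inv, inv_inv, inv_inv⟩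

theorem p_inv {r : ℕ} (a : S r) : p r (inv a) = p r a := by
  rcases a with _ | ⟨i, b⟩ <;> simp [inv, p]

theorem val_inv {r : ℕ} (a : S r) : val (inv a) = (val a)⁻¹ := by
  rcases a with _ | ⟨i, _ | _⟩ <;> simp [inv, val]

theorem p_nonneg {r : ℕ} (a : S r) : 0 ≤ p r a := by
  rcases a with _ | ⟨i, b⟩ <;> simp [p]

theorem p_sum {r : ℕ} (hr : 2 ≤ r) : ∑ a, p r a = 1 := by
  have : (r : ℝ) ≠ 0 := by positivity
  simp [Fintype.sum_option, p]
  field_simp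
  norm_num

theorem sum_inv {r : ℕ} (f : S r → ℝ) : ∑ a, p r a * f (inv a) = ∑ a, p r a * f a := by
  rw [← Equiv.sum_comp (invE r) (fun a => p r a * f a)]
  refine Finset.sum_congr rfl fun a _ => ?_
  show p r a * f (inv a) = p r (inv a) * f (inv a)
  rw [p_inv]

/-- Expectation over lists of i.i.d. letters. -/
def E {A : Type*} [Fintype A] (q : A → ℝ) : ℕ → (List A → ℝ) → ℝ
  | 0, f => f []
  | n + 1, f => ∑ a, q a * E q n (fun l => f (a :: l))

section E
variable {A : Type*} [Fintype A] {q : A → ℝ}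

theorem E_mono (hq : ∀ a, 0 ≤ q a) (n : ℕ) {f g : List A → ℝ}
    (h : ∀ l, l.length = n → f l ≤ g l) : E q n f ≤ E q n g := by
  induction n generalizing f g with
  | zero => exact h [] rfl
  | succ n ih =>
    simp only [E]
    refine Finset.sum_le_sum fun a _ => mul_le_mul_of_nonneg_left (ih ?_) (hq a)
    intro l hl
    exact h _ (by simp [hl])

theorem E_add (n : ℕ) (f g : List A → ℝ) :
    E q n (fun l => f l + g l) = E q n f + E q n g := by
  induction n generalizing f g with
  | zero => rfl
  | succ n ih => simp only [E, ih, mul_add, Finset.sum_add_distrib]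

theorem E_smul (n : ℕ) (c : ℝ) (f : List A → ℝ) :
    E q n (fun l => c * f l) = c * E q n f := by
  induction n generalizing f with
  | zero => rfl
  | succ n ih =>
    simp only [E, ih, Finset.mul_sum]
    exact Finset.sum_congr rfl fun a _ => by ring

theorem E_sum {ι : Type*} (s : Finset ι) (n : ℕ) (f : ι → List A → ℝ) :
    E q n (fun l => ∑ i ∈ s, f i l) = ∑ i ∈ s, E q n (f i) := by
  induction n generalizing f with
  | zero => rfl
  | succ n ih =>
    simp only [E, ih, Finset.mul_sum]
    exact Finset.sum_comm

theorem E_const (hq1 : ∑ a, q a = 1) (n : ℕ) (c : ℝ) : E q n (fun _ => c) = c := by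
  induction n with
  | zero => rfl
  | succ n ih => simp only [E, ih, ← Finset.sum_mul, hq1, one_mul]

end E

open Classical in
theorem lazySRW_eq {r : ℕ} (g : FreeGroup (Fin r)) :
    lazySRW r g = ∑ a : S r, p r a * (if val a = g then 1 else 0) := by
  have hinj : ∀ i j : Fin r, FreeGroup.of i = FreeGroup.of j ↔ i = j := fun i j =>
    FreeGroup.of_injective.eq_iff
  have hne : ∀ i j : Fin r, (FreeGroup.of i)⁻¹ ≠ FreeGroup.of j := by
    intro i j h
    have := congrArg FreeGroup.toWord h
    simp [FreeGroup.toWord_inv, FreeGroup.invRev] at this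
  have hne' : ∀ i j : Fin r, FreeGroup.of i ≠ (FreeGroup.of j)⁻¹ := fun i j h => hne j i h.symm
  simp only [Fintype.sum_option, Fintype.sum_prod_type, Fintype.sum_bool, p, val, lazySRW]
  by_cases h1 : g = 1
  · subst h1
    have h2 : ∀ i : Fin r, FreeGroup.of i ≠ 1 := fun i => FreeGroup.of_ne_one i
    simp [h2]
  · have h1' : (1 : FreeGroup (Fin r)) ≠ g := Ne.symm h1
    rw [if_neg h1]
    by_cases h2 : ∃ i : Fin r, g = FreeGroup.of i ∨ g = (FreeGroup.of i)⁻¹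
    · rw [if_pos h2]
      obtain ⟨i, rfl | rfl⟩ := h2
      · simp [hinj, hne, h1']
      · simp [hinj, hne', h1', -zero_eq_inv, -one_eq_inv]
    · rw [if_neg h2]
      simp only [not_exists, not_or] at h2
      symm
      have h3 : ∀ i, FreeGroup.of i ≠ g := fun i h => (h2 i).1 h.symm
      have h4 : ∀ i, (FreeGroup.of i)⁻¹ ≠ g := fun i h => (h2 i).2 h.symm
      simp [h3, h4, h1']

section Q
variable {r : ℕ} (M : Subgroup (FreeGroup (Fin r))) [M.Normal]

open Classical in
theorem lazySRWQuot_eq (h : FreeGroup (Fin r) ⧸ M) :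
    lazySRWQuot r M h = ∑ a : S r, p r a * (if (QuotientGroup.mk (val a) : FreeGroup (Fin r) ⧸ M) = h then 1 else 0) := by
  unfold lazySRWQuot pushforward
  simp only [lazySRW_eq]
  have key : ∀ a : S r, HasSum (fun g : {g : FreeGroup (Fin r) // (QuotientGroup.mk g : FreeGroup (Fin r) ⧸ M) = h} =>
      p r a * (if val a = g.1 then (1:ℝ) else 0))
      (p r a * (if (QuotientGroup.mk (val a) : FreeGroup (Fin r) ⧸ M) = h then 1 else 0)) := by
    intro a
    split_ifs with hh
    · have := hasSum_single (f := fun g : {g : FreeGroup (Fin r) // (QuotientGroup.mk g : FreeGroup (Fin r) ⧸ M) = h} =>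
        p r a * (if val a = g.1 then (1:ℝ) else 0)) ⟨val a, hh⟩ (by
          intro b hb
          have : val a ≠ b.1 := fun h' => hb (Subtype.ext h'.symm)
          simp [this])
      simpa using this
    · have : (fun g : {g : FreeGroup (Fin r) // (QuotientGroup.mk g : FreeGroup (Fin r) ⧸ M) = h} =>
        p r a * (if val a = g.1 then (1:ℝ) else 0)) = fun _ => 0 := by
        funext g
        have : val a ≠ g.1 := fun h' => hh (h' ▸ g.2)
        simp [this]
      rw [this]
      simp
  exact (hasSum_sum fun a _ => key a).tsum_eq

open Classical in
theorem conv_eq (ν : FreeGroup (Fin r) ⧸ M → ℝ) (g : FreeGroup (Fin r) ⧸ M) :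
    conv (lazySRWQuot r M) ν g =
      ∑ a : S r, p r a * ν ((QuotientGroup.mk (val a))⁻¹ * g) := by
  unfold conv
  simp only [lazySRWQuot_eq, Finset.sum_mul]
  have key : ∀ a : S r, HasSum (fun h : FreeGroup (Fin r) ⧸ M =>
      p r a * (if (QuotientGroup.mk (val a) : FreeGroup (Fin r) ⧸ M) = h then (1:ℝ) else 0) * ν (h⁻¹ * g))
      (p r a * ν ((QuotientGroup.mk (val a))⁻¹ * g)) := by
    intro a
    have := hasSum_single (f := fun h : FreeGroup (Fin r) ⧸ M =>
      p r a * (if (QuotientGroup.mk (val a) : FreeGroup (Fin r) ⧸ M) = h then (1:ℝ) else 0) * ν (h⁻¹ * g))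
      (QuotientGroup.mk (val a)) (by
        intro b hb
        simp [Ne.symm hb])
    simpa using this
  exact (hasSum_sum fun a _ => key a).tsum_eq

/-- the n-step distribution -/
abbrev u (n : ℕ) : FreeGroup (Fin r) ⧸ M → ℝ := convPow (lazySRWQuot r M) n

theorem u_succ (n : ℕ) (g : FreeGroup (Fin r) ⧸ M) :
    u M (n + 1) g = ∑ a : S r, p r a * u M n ((QuotientGroup.mk (val a))⁻¹ * g) :=
  conv_eq M _ g

theorem u_nonneg (n : ℕ) (g : FreeGroup (Fin r) ⧸ M) : 0 ≤ u M n g := by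
  induction n generalizing g with
  | zero => simp only [u, convPow]; split_ifs <;> norm_num
  | succ n ih =>
    rw [u_succ]
    exact Finset.sum_nonneg fun a _ => mul_nonneg (p_nonneg a) (ih _)

theorem u_succ' (n : ℕ) (g : FreeGroup (Fin r) ⧸ M) :
    u M (n + 1) g = ∑ a : S r, p r a * u M n (g * (QuotientGroup.mk (val a))⁻¹) := by
  induction n generalizing g with
  | zero =>
    rw [u_succ]
    refine Finset.sum_congr rfl fun a _ => ?_
    simp only [u, convPow]
    congr 2
    rw [inv_mul_eq_one, mul_inv_eq_one]
    exact propext ⟨Eq.symm, Eq.symm⟩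
  | succ n ih =>
    rw [u_succ]
    conv_lhs => simp only [ih, Finset.mul_sum]
    rw [Finset.sum_comm]
    refine Finset.sum_congr rfl fun a _ => ?_
    rw [u_succ, Finset.mul_sum]
    refine Finset.sum_congr rfl fun b _ => ?_
    rw [mul_assoc]; ring

theorem u_inv (n : ℕ) (g : FreeGroup (Fin r) ⧸ M) : u M n g⁻¹ = u M n g := by
  induction n generalizing g with
  | zero =>
    simp only [u, convPow]
    by_cases h : g = 1
    · subst h; simp
    · rw [if_neg h, if_neg (by simpa using h)]
  | succ n ih =>
    rw [u_succ, u_succ', ← sum_inv]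
    refine Finset.sum_congr rfl fun a _ => ?_
    rw [val_inv, ← ih]
    simp

/-- value of a list of steps in the quotient -/
def lval (l : List (S r)) : FreeGroup (Fin r) ⧸ M :=
  (l.map fun a => (QuotientGroup.mk (val a) : FreeGroup (Fin r) ⧸ M)).prod

theorem u_add (n m : ℕ) (g : FreeGroup (Fin r) ⧸ M) :
    u M (n + m) g = E (p r) n (fun l => u M m ((lval M l)⁻¹ * g)) := by
  induction n generalizing g with
  | zero => simp [E, lval]
  | succ n ih =>
    rw [show n + 1 + m = n + m + 1 by ring, u_succ]
    simp only [E, ih]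
    refine Finset.sum_congr rfl fun a _ => ?_
    simp [lval, mul_assoc]

open Classical in
theorem u_eq_E (n : ℕ) (g : FreeGroup (Fin r) ⧸ M) :
    u M n g = E (p r) n (fun l => if lval M l = g then 1 else 0) := by
  have := u_add M n 0 g
  rw [add_zero] at this
  rw [this]
  congr 1
  funext l
  simp only [u, convPow]
  congr 1
  rw [inv_mul_eq_one]

open Classical in
theorem u_lower (n : ℕ) (U : Finset (FreeGroup (Fin r) ⧸ M)) (f : List (S r) → ℝ) (hf : ∀ l, l.length = n →
    f l ≤ if lval M l ∈ U then 1 else 0) (hE : 0 ≤ E (p r) n f) :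
    (E (p r) n f) ^ 2 ≤ U.card * u M (2 * n) 1 := by
  have h1 : ∑ g ∈ U, (u M n g) ^ 2 ≤ u M (2 * n) 1 := by
    rw [two_mul, u_add]
    have : ∑ g ∈ U, (u M n g) ^ 2 =
      E (p r) n (fun l => ∑ g ∈ U, u M n g * (if lval M l = g then 1 else 0)) := by
      rw [E_sum]
      refine Finset.sum_congr rfl fun g _ => ?_
      rw [E_smul, ← u_eq_E, sq]
    rw [this]
    refine E_mono p_nonneg n fun l _ => ?_
    rw [mul_one, u_inv]
    simp only [mul_ite, mul_one, mul_zero, Finset.sum_ite_eq]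
    split_ifs
    · exact le_rfl
    · exact u_nonneg _ _ _
  have h2 : E (p r) n f ≤ ∑ g ∈ U, u M n g := by
    simp only [u_eq_E M n]
    rw [← E_sum]
    refine E_mono p_nonneg n fun l hl => (hf l hl).trans ?_
    simp
  calc (E (p r) n f) ^ 2 ≤ (∑ g ∈ U, u M n g) ^ 2 := by gcongr
    _ ≤ U.card * ∑ g ∈ U, (u M n g) ^ 2 := sq_sum_le_card_mul_sum_sq
    _ ≤ _ := by gcongr

end Q

end FM

namespace FM

/-- displacement of a step -/
def dl {r : ℕ} : S r → (Fin r → ℤ)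
  | none => 0
  | some (i, true) => Pi.single i 1
  | some (i, false) => -Pi.single i 1

/-- abelianization to `ℤ^r` -/
def ab (r : ℕ) : FreeGroup (Fin r) →* Multiplicative (Fin r → ℤ) :=
  FreeGroup.lift fun i => Multiplicative.ofAdd (Pi.single i 1)

theorem ab_of {r : ℕ} (i : Fin r) : ab r (FreeGroup.of i) = Multiplicative.ofAdd (Pi.single i 1) := by
  simp [ab]

theorem ab_ker {r : ℕ} (g : FreeGroup (Fin r)) (h : ab r g = 1) : g ∈ derivedSeries (FreeGroup (Fin r)) 1 := by
  let ψ : Multiplicative (Fin r → ℤ) →* Abelianization (FreeGroup (Fin r)) :=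
    { toFun := fun x => ∏ i, (Abelianization.of (FreeGroup.of i)) ^ (Multiplicative.toAdd x i)
      map_one' := by simp
      map_mul' := fun x y => by simp [zpow_add, Finset.prod_mul_distrib] }
  have hc : ψ.comp (ab r) = Abelianization.of := by
    apply FreeGroup.ext_hom
    intro i
    simp only [MonoidHom.comp_apply, ab_of]
    show ∏ j, (Abelianization.of (FreeGroup.of j)) ^ ((Pi.single i 1 : Fin r → ℤ) j) = _
    rw [Finset.prod_eq_single i]
    · simp
    · intro j _ hj
      simp [Pi.single_eq_of_ne hj]
    · simp
  have h1 : Abelianization.of g = 1 := by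
    rw [← hc, MonoidHom.comp_apply, h, map_one]
  rw [derivedSeries_one, ← Abelianization.ker_of]
  exact h1

theorem comm_of_ab {r : ℕ} (x y : FreeGroup (Fin r)) (hx : ab r x = 1) (hy : ab r y = 1) :
    (QuotientGroup.mk x * QuotientGroup.mk y : FreeGroup (Fin r) ⧸ derivedSeries (FreeGroup (Fin r)) 2)
      = QuotientGroup.mk y * QuotientGroup.mk x := by
  rw [← QuotientGroup.mk_mul, ← QuotientGroup.mk_mul, QuotientGroup.eq]
  have h := Subgroup.commutator_mem_commutator (ab_ker y⁻¹ (by simp [hy])) (ab_ker x⁻¹ (by simp [hx]))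
  rw [← derivedSeries_succ] at h
  convert h using 1
  simp [commutatorElement_def, mul_assoc]

theorem exists_comm_prod {Q : Type*} [Group Q] {ι : Type*} [Fintype ι] [DecidableEq ι] (N : Subgroup Q)
    (hN : ∀ a ∈ N, ∀ b ∈ N, a * b = b * a) (γ : ι → Q) (hγ : ∀ e, γ e ∈ N) :
    ∃ Γ : (ι → ℤ) → Q, Γ 0 = 1 ∧ ∀ k e (c : ℤ), Γ (k + Pi.single e c) = γ e ^ c * Γ k := by
  let _ : CommGroup N := { (inferInstance : Group N) with
    mul_comm := fun a b => Subtype.ext (hN a.1 a.2 b.1 b.2) }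
  refine ⟨fun k => ((∏ e, (⟨γ e, hγ e⟩ : N) ^ k e : N) : Q), ?_, ?_⟩
  · simp
  · intro k e c
    have : (∏ e', (⟨γ e', hγ e'⟩ : N) ^ (k + Pi.single e c : ι → ℤ) e' : N) =
      (⟨γ e, hγ e⟩ : N) ^ c * ∏ e', (⟨γ e', hγ e'⟩ : N) ^ k e' := by
      simp only [Pi.add_apply, zpow_add, Finset.prod_mul_distrib]
      rw [mul_comm]
      congr 1
      rw [Finset.prod_eq_single e]
      · simp
      · intro j _ hj
        simp [Pi.single_eq_of_ne hj]
      · simp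
    have h2 := congrArg (fun z : N => (z : Q)) this
    exact h2

theorem exists_section {r : ℕ} (x : Fin r → ℤ) : ∃ g : FreeGroup (Fin r), ab r g = Multiplicative.ofAdd x := by
  refine ⟨(List.ofFn fun i => FreeGroup.of i ^ x i).prod, ?_⟩
  rw [map_list_prod, List.map_ofFn, List.prod_ofFn]
  simp only [Function.comp, map_zpow, ab_of]
  apply Multiplicative.toAdd.injective
  rw [toAdd_prod]
  funext j
  simp [Finset.sum_apply, Pi.single_apply]

/-- staying in a finite set -/
def stay {r : ℕ} (B : Finset (Fin r → ℤ)) : List (S r) → (Fin r → ℤ) → Prop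
  | [], x => x ∈ B
  | a :: l, x => x ∈ B ∧ stay B l (x + dl a)

theorem stay_mem {r : ℕ} {B : Finset (Fin r → ℤ)} {l : List (S r)} {x : Fin r → ℤ} (h : stay B l x) :
    x ∈ B := by
  cases l with
  | nil => exact h
  | cons a l => exact h.1

open Classical in
theorem stay_card {r : ℕ} (B : Finset (Fin r → ℤ)) (n : ℕ) :
    ∃ U : Finset (FreeGroup (Fin r) ⧸ derivedSeries (FreeGroup (Fin r)) 2),
      U.card ≤ (2 * n + 1) ^ (B.card * r) * B.card ∧
      ∀ l : List (S r), l.length = n → stay B l 0 → lval _ l ∈ U := by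
  choose t ht using fun x => exists_section (r := r) x
  set D2 := derivedSeries (FreeGroup (Fin r)) 2 with hD2
  let T : (Fin r → ℤ) → FreeGroup (Fin r) ⧸ D2 := fun x => QuotientGroup.mk (t x)
  let γ' : (Fin r → ℤ) → Fin r → FreeGroup (Fin r) := fun x i =>
    t x * FreeGroup.of i * (t (x + Pi.single i 1))⁻¹
  have hγ' : ∀ x i, ab r (γ' x i) = 1 := by
    intro x i
    simp [γ', ht, ab_of]
  let γ : ↥B × Fin r → FreeGroup (Fin r) ⧸ D2 := fun e => QuotientGroup.mk (γ' e.1 e.2)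
  obtain ⟨Γ, hΓ0, hΓ⟩ := exists_comm_prod (Subgroup.map (QuotientGroup.mk' D2) (ab r).ker)
    (by
      rintro _ ⟨x, hx, rfl⟩ _ ⟨y, hy, rfl⟩
      exact comm_of_ab x y hx hy) γ (fun e => ⟨γ' e.1 e.2, hγ' _ _, rfl⟩)
  have hstep : ∀ x i, T x * QuotientGroup.mk (FreeGroup.of i) = QuotientGroup.mk (γ' x i) * T (x + Pi.single i 1) := by
    intro x i
    simp only [T, γ']
    rw [← QuotientGroup.mk_mul, ← QuotientGroup.mk_mul]
    congr 1
    group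
  have main : ∀ (l : List (S r)) (x), stay B l x → ∃ k : ↥B × Fin r → ℤ, (∀ e, |k e| ≤ l.length) ∧
      ∃ y ∈ B, T x * lval D2 l = Γ k * T y := by
    intro l
    induction l with
    | nil =>
      intro x hx
      exact ⟨0, by simp, x, hx, by simp [lval, hΓ0]⟩
    | cons a l ih =>
      rintro x ⟨hx, hs⟩
      obtain ⟨k, hk, y, hy, he⟩ := ih _ hs
      have hl : lval D2 (a :: l) = QuotientGroup.mk (val a) * lval D2 l := by simp [lval]
      have hadd : ∀ (e : ↥B × Fin r) (c : ℤ), |c| ≤ 1 → ∀ e', |(k + Pi.single e c : ↥B × Fin r → ℤ) e'| ≤ ((a :: l).length : ℤ) := by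
        intro e c hc e'
        rw [Pi.add_apply]
        refine (abs_add_le _ _).trans ?_
        have h1 : |(Pi.single e c : ↥B × Fin r → ℤ) e'| ≤ 1 := by
          by_cases h : e' = e
          · subst h; simpa using hc
          · simp [Pi.single_eq_of_ne h]
        have := hk e'
        simp only [List.length_cons]
        push_cast
        linarith
      rcases a with _ | ⟨i, b⟩
      · refine ⟨k, fun e => (hk e).trans (by simp), y, hy, ?_⟩
        rw [hl]
        simpa [val, dl] using he
      · cases b
        · have hm := stay_mem hs
          refine ⟨k + Pi.single (⟨_, hm⟩, i) (-1), hadd _ _ (by simp), y, hy, ?_⟩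
          rw [hΓ, mul_assoc, ← he, hl, ← mul_assoc, ← mul_assoc]
          congr 1
          have := hstep (x + dl (some (i, false))) i
          simp only [dl, neg_add_cancel_right, val] at this ⊢
          rw [zpow_neg_one]
          simp only [γ]
          rw [eq_inv_mul_iff_mul_eq, ← mul_assoc, ← this, QuotientGroup.mk_inv]
          simp
        · refine ⟨k + Pi.single (⟨x, hx⟩, i) 1, hadd _ _ (by simp), y, hy, ?_⟩
          rw [hΓ, mul_assoc, ← he, hl, ← mul_assoc, ← mul_assoc]
          congr 1
          rw [zpow_one]
          exact hstep x i
  refine ⟨((Fintype.piFinset fun _ : ↥B × Fin r => Finset.Icc (-(n : ℤ)) n) ×ˢ B).image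
    (fun z => (T 0)⁻¹ * (Γ z.1 * T z.2)), ?_, ?_⟩
  · refine Finset.card_image_le.trans ?_
    rw [Finset.card_product, Fintype.card_piFinset]
    simp only [Finset.prod_const, Finset.card_univ, Fintype.card_prod, Fintype.card_coe, Fintype.card_fin, Int.card_Icc]
    have : ((n : ℤ) + 1 - -(n : ℤ)).toNat = 2 * n + 1 := by omega
    rw [this]
  · intro l hl hs
    obtain ⟨k, hk, y, hy, he⟩ := main l 0 hs
    refine Finset.mem_image.2 ⟨(k, y), ?_, ?_⟩
    · rw [Finset.mem_product]
      refine ⟨?_, hy⟩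
      rw [Fintype.mem_piFinset]
      intro e
      rw [Finset.mem_Icc, ← abs_le, ← hl]
      exact hk e
    · simp only
      rw [← he, inv_mul_cancel_left]

open Classical in
theorem stay_prob {r : ℕ} (B : Finset (Fin r → ℤ)) (c : (Fin r → ℤ) → ℝ) (ρ : ℝ) (hρ : 0 ≤ ρ)
    (hc1 : ∀ x, c x ≤ 1) (hcB : ∀ x, x ∉ B → c x = 0)
    (hc : ∀ x, ρ * c x ≤ ∑ a, p r a * c (x + dl a)) (n : ℕ) (x : Fin r → ℤ) :
    ρ ^ n * c x ≤ E (p r) n (fun l => if stay B l x then 1 else 0) := by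
  induction n generalizing x with
  | zero =>
    simp only [E, pow_zero, one_mul]
    split_ifs with h
    · exact hc1 x
    · exact (hcB x h).le
  | succ n ih =>
    by_cases hx : x ∈ B
    · simp only [E, stay, hx, true_and]
      calc ρ ^ (n + 1) * c x = ρ ^ n * (ρ * c x) := by ring
        _ ≤ ρ ^ n * ∑ a, p r a * c (x + dl a) := by gcongr; exact hc x
        _ = ∑ a, p r a * (ρ ^ n * c (x + dl a)) := by
          rw [Finset.mul_sum]; exact Finset.sum_congr rfl fun a _ => by ring
        _ ≤ _ := Finset.sum_le_sum fun a _ => mul_le_mul_of_nonneg_left (ih _) (p_nonneg a)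
    · rw [hcB x hx, mul_zero]
      simp [E, stay, hx]
      have : E (p r) n (fun _ => (0:ℝ)) = 0 := by
        have := E_smul (q := p r) n 0 (fun _ => 0)
        simpa using this
      simp [this]

/-- one-dimensional profile -/
def g1 (R : ℕ) (k : ℤ) : ℝ := if |k| ≤ (R : ℤ) then Real.cos (Real.pi * k / (2 * R)) else 0

theorem g1_nonneg (R : ℕ) (hR : 1 ≤ R) (k : ℤ) : 0 ≤ g1 R k := by
  unfold g1
  split_ifs with h
  · have hR' : (0:ℝ) < R := by exact_mod_cast hR
    have h' : |(k:ℝ)| ≤ R := by exact_mod_cast h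
    rw [abs_le] at h'
    have hp := Real.pi_pos
    apply Real.cos_nonneg_of_mem_Icc
    constructor
    · rw [le_div_iff₀ (by positivity)]
      nlinarith [mul_le_mul_of_nonneg_left h'.1 hp.le]
    · rw [div_le_iff₀ (by positivity)]
      nlinarith [mul_le_mul_of_nonneg_left h'.2 hp.le]
  · exact le_rfl

theorem g1_le_one (R : ℕ) (k : ℤ) : g1 R k ≤ 1 := by
  unfold g1
  split_ifs with h
  · exact Real.cos_le_one _
  · norm_num

theorem g1_step (R : ℕ) (hR : 1 ≤ R) (k : ℤ) :
    2 * Real.cos (Real.pi / (2 * R)) * g1 R k ≤ g1 R (k + 1) + g1 R (k - 1) := by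
  have hR' : (0:ℝ) < R := by exact_mod_cast hR
  have h0 := add_nonneg (g1_nonneg R hR (k+1)) (g1_nonneg R hR (k-1))
  by_cases h : |k| < (R : ℤ)
  · rw [abs_lt] at h
    have h1 : |k| ≤ (R:ℤ) := abs_le.2 ⟨by omega, by omega⟩
    have h2 : |k+1| ≤ (R:ℤ) := abs_le.2 ⟨by omega, by omega⟩
    have h3 : |k-1| ≤ (R:ℤ) := abs_le.2 ⟨by omega, by omega⟩
    simp only [g1, h1, h2, h3, if_true]
    push_cast
    rw [show Real.pi * ((k:ℝ) + 1) / (2 * R) = Real.pi * k / (2 * R) + Real.pi / (2 * R) by ring,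
      show Real.pi * ((k:ℝ) - 1) / (2 * R) = Real.pi * k / (2 * R) - Real.pi / (2 * R) by ring,
      Real.cos_add, Real.cos_sub]
    apply le_of_eq; ring
  · suffices hg : g1 R k = 0 by rw [hg, mul_zero]; exact h0
    unfold g1
    split_ifs with h'
    · have : |k| = R := le_antisymm h' (not_lt.1 h)
      rcases (abs_eq (by positivity)).1 this with hk | hk
      · subst hk
        rw [show Real.pi * ((R:ℤ):ℝ) / (2 * R) = Real.pi / 2 by push_cast; field_simp]
        exact Real.cos_pi_div_two
      · subst hk
        rw [show Real.pi * ((-(R:ℤ) : ℤ):ℝ) / (2 * R) = -(Real.pi / 2) by push_cast; field_simp]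
        rw [Real.cos_neg]
        exact Real.cos_pi_div_two
    · rfl

theorem c_step {r : ℕ} (hr : 2 ≤ r) (R : ℕ) (hR : 1 ≤ R) (x : Fin r → ℤ) :
    (1 + Real.cos (Real.pi / (2 * R))) / 2 * ∏ i, g1 R (x i) ≤ ∑ a, p r a * ∏ i, g1 R ((x + dl a) i) := by
  have hr' : (0:ℝ) < r := by positivity
  set C := Real.cos (Real.pi / (2 * R)) with hC
  have key : ∀ i : Fin r, 2 * C * ∏ j, g1 R (x j) ≤
      ∏ j, g1 R ((x + Pi.single i 1 : Fin r → ℤ) j) + ∏ j, g1 R ((x + -Pi.single i 1 : Fin r → ℤ) j) := by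
    intro i
    have hfac : ∀ y : Fin r → ℤ, (∀ j, j ≠ i → y j = x j) →
        ∏ j, g1 R (y j) = g1 R (y i) * ∏ j ∈ Finset.univ.erase i, g1 R (x j) := by
      intro y hy
      rw [← Finset.mul_prod_erase _ _ (Finset.mem_univ i)]
      congr 1
      refine Finset.prod_congr rfl fun j hj => ?_
      rw [hy j (Finset.ne_of_mem_erase hj)]
    rw [hfac x (fun _ _ => rfl), hfac (x + Pi.single i 1) (fun j hj => by simp [hj]),
      hfac (x + -Pi.single i 1) (fun j hj => by simp [hj]), ← add_mul, ← mul_assoc]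
    refine mul_le_mul_of_nonneg_right ?_ (Finset.prod_nonneg fun j _ => g1_nonneg R hR _)
    simpa [sub_eq_add_neg] using g1_step R hR (x i)
  simp only [Fintype.sum_option, Fintype.sum_prod_type, Fintype.sum_bool, p, dl, add_zero]
  have : ∑ i : Fin r, 1 / (4 * (r:ℝ)) * (2 * C * ∏ j, g1 R (x j)) ≤
    ∑ i : Fin r, (1 / (4 * (r:ℝ)) * ∏ j, g1 R ((x + Pi.single i 1 : Fin r → ℤ) j) + 1 / (4 * (r:ℝ)) * ∏ j, g1 R ((x + -Pi.single i 1 : Fin r → ℤ) j)) := by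
    refine Finset.sum_le_sum fun i _ => ?_
    rw [← mul_add]
    exact mul_le_mul_of_nonneg_left (key i) (by positivity)
  refine le_trans (le_of_eq ?_) (add_le_add le_rfl this)
  simp only [Finset.sum_const, Finset.card_univ, Fintype.card_fin, nsmul_eq_mul]
  field_simp
  ring

theorem lower_main {r : ℕ} (hr : 2 ≤ r) (R : ℕ) (hR : 1 ≤ R) (n : ℕ) :
    ((1 + Real.cos (Real.pi / (2 * R))) / 2) ^ (2 * n) ≤
      (2 * n + 1 : ℝ) ^ ((2 * R + 1) ^ r * r) * (2 * R + 1 : ℝ) ^ r *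
        u (derivedSeries (FreeGroup (Fin r)) 2) (2 * n) 1 := by
  classical
  set B : Finset (Fin r → ℤ) := Fintype.piFinset fun _ => Finset.Icc (-(R:ℤ)) R with hB
  have hBc : B.card = (2 * R + 1) ^ r := by
    rw [hB, Fintype.card_piFinset]
    simp only [Finset.prod_const, Finset.card_univ, Fintype.card_fin, Int.card_Icc]
    congr 1; omega
  set ρ := (1 + Real.cos (Real.pi / (2 * R))) / 2 with hρ
  have hρ0 : 0 ≤ ρ := by have := Real.neg_one_le_cos (Real.pi / (2 * R)); rw [hρ]; linarith
  have hst := stay_prob B (fun x => ∏ i, g1 R (x i)) ρ hρ0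
    (fun x => Finset.prod_le_one (fun i _ => g1_nonneg R hR _) (fun i _ => g1_le_one R _))
    (by
      intro x hx
      rw [hB, Fintype.mem_piFinset] at hx
      push Not at hx
      obtain ⟨i, hi⟩ := hx
      refine Finset.prod_eq_zero (Finset.mem_univ i) ?_
      rw [Finset.mem_Icc, ← abs_le] at hi
      simp [g1, hi])
    (fun x => c_step hr R hR x) n 0
  have hg0 : ∏ i : Fin r, g1 R ((0 : Fin r → ℤ) i) = 1 := by simp [g1]
  simp only [hg0, mul_one] at hst
  obtain ⟨U, hU, hU'⟩ := stay_card B n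
  have h1 := u_lower (derivedSeries (FreeGroup (Fin r)) 2) n U (fun l => if stay B l 0 then 1 else 0) (by
    intro l hl
    split_ifs with h1 h2 h2
    · exact le_rfl
    · exact absurd (hU' l hl h1) h2
    · norm_num
    · norm_num) ((pow_nonneg hρ0 n).trans hst)
  have h2 : (U.card : ℝ) ≤ (2 * n + 1 : ℝ) ^ ((2 * R + 1) ^ r * r) * (2 * R + 1 : ℝ) ^ r := by
    rw [hBc] at hU
    exact_mod_cast hU
  calc ρ ^ (2 * n) = (ρ ^ n) ^ 2 := by rw [← pow_mul, mul_comm]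
    _ ≤ _ := by gcongr
    _ ≤ _ := h1
    _ ≤ _ := mul_le_mul_of_nonneg_right h2 (u_nonneg _ _ _)

end FM

namespace FM

/-- half-line indicator -/
def H {r : ℕ} (i : Fin r) (x : Fin r → ℤ) : (Fin r → ℤ) → ℤ := fun y =>
  if y i < x i ∧ ∀ k, k ≠ i → y k = x k then 1 else 0

open Classical in
theorem H_diff {r : ℕ} (i : Fin r) (x : Fin r → ℤ) :
    H i (x + Pi.single i 1) = H i x + Pi.single x 1 := by
  funext y
  have h1 : (∀ k, k ≠ i → y k = (x + Pi.single i 1 : Fin r → ℤ) k) ↔ ∀ k, k ≠ i → y k = x k := by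
    refine forall_congr' fun k => forall_congr' fun hk => ?_
    simp [hk]
  have h2 : H i (x + Pi.single i 1) y = if y i < x i + 1 ∧ ∀ k, k ≠ i → y k = x k then 1 else 0 := by
    simp only [H, h1]
    simp
  rw [Pi.add_apply, h2]
  simp only [H]
  by_cases h2 : ∀ k, k ≠ i → y k = x k
  · by_cases h3 : y = x
    · subst h3; simp
    · have : y i ≠ x i := by
        intro h
        apply h3
        funext k
        by_cases hk : k = i
        · rw [hk, h]
        · exact h2 k hk
      rw [Pi.single_eq_of_ne h3]
      by_cases h4 : y i < x i
      · rw [if_pos ⟨by omega, h2⟩, if_pos ⟨h4, h2⟩]; simp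
      · rw [if_neg fun h => by have := h.1; omega, if_neg fun h => h4 h.1]; simp
  · have h3 : y ≠ x := by
      rintro rfl
      exact h2 fun _ _ => rfl
    rw [if_neg fun h => h2 h.2, if_neg fun h => h2 h.2, Pi.single_eq_of_ne h3]; simp

/-- state space: configuration and position -/
abbrev X (r : ℕ) := ((Fin r → ℤ) → ℤ) × (Fin r → ℤ)

/-- configuration increment of a step -/
def ph {r : ℕ} (i j : Fin r) : S r → (Fin r → ℤ) → ((Fin r → ℤ) → ℤ)
  | none, _ => 0
  | some (k, true), x => if k = j then H i x else 0
  | some (k, false), x => if k = j then -H i (x - Pi.single k 1) else 0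

/-- one step -/
def st {r : ℕ} (i j : Fin r) (a : S r) (s : X r) : X r := (s.1 + ph i j a s.2, s.2 + dl a)

theorem st_tf {r : ℕ} (i j k : Fin r) (s : X r) :
    st i j (some (k, true)) (st i j (some (k, false)) s) = s := by
  rcases s with ⟨F, x⟩
  simp only [st, ph, dl]
  ext1
  · simp only
    split_ifs <;> simp [sub_eq_add_neg]
  · simp

theorem st_ft {r : ℕ} (i j k : Fin r) (s : X r) :
    st i j (some (k, false)) (st i j (some (k, true)) s) = s := by
  rcases s with ⟨F, x⟩
  simp only [st, ph, dl]
  ext1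
  · simp only
    split_ifs <;> simp
  · simp

/-- generator as a permutation -/
def mv {r : ℕ} (i j k : Fin r) : Equiv.Perm (X r) :=
  ⟨st i j (some (k, true)), st i j (some (k, false)), st_ft i j k, st_tf i j k⟩

/-- representation of the free group -/
def rh {r : ℕ} (i j : Fin r) : FreeGroup (Fin r) →* Equiv.Perm (X r) :=
  FreeGroup.lift fun k => (mv i j k)⁻¹

theorem rh_val {r : ℕ} (i j : Fin r) (a : S r) (s : X r) : (rh i j (val a))⁻¹ s = st i j a s := by
  rcases a with _ | ⟨k, _ | _⟩
  · simp [val, st, ph, dl]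
  · simp only [val, rh, map_inv, FreeGroup.lift_apply_of, _root_.inv_inv]
    rfl
  · simp only [val, rh, FreeGroup.lift_apply_of, _root_.inv_inv]
    rfl

theorem rh_form {r : ℕ} (i j : Fin r) (g : FreeGroup (Fin r)) :
    ∃ (Φ : (Fin r → ℤ) → ((Fin r → ℤ) → ℤ)) (v : Fin r → ℤ), ∀ s : X r, rh i j g s = (s.1 + Φ s.2, s.2 + v) := by
  induction g using FreeGroup.induction_on with
  | C1 => exact ⟨0, 0, fun s => by simp⟩
  | of k =>
    refine ⟨ph i j (some (k, false)), dl (some (k, false)), fun s => ?_⟩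
    simp only [rh, FreeGroup.lift_apply_of]
    rfl
  | inv_of k _ =>
    refine ⟨ph i j (some (k, true)), dl (some (k, true)), fun s => ?_⟩
    simp only [rh, map_inv, FreeGroup.lift_apply_of, _root_.inv_inv]
    rfl
  | mul a b ha hb =>
    obtain ⟨Φ, v, h⟩ := ha
    obtain ⟨Ψ, w, h'⟩ := hb
    refine ⟨fun x => Ψ x + Φ (x + w), w + v, fun s => ?_⟩
    rw [map_mul, Equiv.Perm.mul_apply, h', h]
    simp [add_assoc]

theorem rh_inv_snd {r : ℕ} (i j : Fin r) (g : FreeGroup (Fin r)) :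
    ∃ v : Fin r → ℤ, (∀ s : X r, (rh i j g s).2 = s.2 + v) ∧ ∀ s : X r, ((rh i j g)⁻¹ s).2 = s.2 - v := by
  obtain ⟨Φ, v, h⟩ := rh_form i j g
  refine ⟨v, fun s => by rw [h], fun s => ?_⟩
  have := h ((rh i j g)⁻¹ s)
  rw [show (rh i j g) ((rh i j g)⁻¹ s) = s by simp] at this
  have h2 := congrArg Prod.snd this
  simp only at h2
  rw [h2]; simp

theorem rh_comm {r : ℕ} (i j : Fin r) (g : FreeGroup (Fin r)) (hg : g ∈ derivedSeries (FreeGroup (Fin r)) 1) :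
    ∃ (Φ : (Fin r → ℤ) → ((Fin r → ℤ) → ℤ)), ∀ s : X r, rh i j g s = (s.1 + Φ s.2, s.2) := by
  let A : Subgroup (FreeGroup (Fin r)) :=
    { carrier := {g | ∀ s : X r, (rh i j g s).2 = s.2}
      one_mem' := by intro s; simp
      mul_mem' := by
        intro a b ha hb s
        rw [map_mul, Equiv.Perm.mul_apply, ha, hb]
      inv_mem' := by
        intro a ha s
        have := ha ((rh i j a)⁻¹ s)
        rw [show (rh i j a) ((rh i j a)⁻¹ s) = s by simp] at this
        rw [map_inv, ← this] }
  have hA : derivedSeries (FreeGroup (Fin r)) 1 ≤ A := by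
    rw [derivedSeries_succ, Subgroup.commutator_le]
    intro a _ b _ s
    obtain ⟨v, h1, h2⟩ := rh_inv_snd i j a
    obtain ⟨w, h3, h4⟩ := rh_inv_snd i j b
    rw [commutatorElement_def]
    simp only [map_mul, map_inv, Equiv.Perm.mul_apply]
    rw [h1, h3, h2, h4]
    abel
  obtain ⟨Φ, v, h⟩ := rh_form i j g
  refine ⟨Φ, fun s => ?_⟩
  have h1 := hA hg s
  rw [h] at h1 ⊢
  ext1
  · rfl
  · exact h1

theorem rh_ker {r : ℕ} (i j : Fin r) (g : FreeGroup (Fin r)) (hg : g ∈ derivedSeries (FreeGroup (Fin r)) 2) :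
    rh i j g = 1 := by
  have : derivedSeries (FreeGroup (Fin r)) 2 ≤ (rh i j).ker := by
    rw [derivedSeries_succ, Subgroup.commutator_le]
    intro a ha b hb
    obtain ⟨Φ, h1⟩ := rh_comm i j a ha
    obtain ⟨Ψ, h2⟩ := rh_comm i j b hb
    rw [MonoidHom.mem_ker, map_commutatorElement, commutatorElement_eq_one_iff_mul_comm]
    ext1 s
    simp only [Equiv.Perm.mul_apply, h1, h2]
    ext1
    · simp only; abel
    · rfl
  exact this hg

open Classical in
/-- probability that the configuration equals `G` after `n` steps from `s` -/
def hh {r : ℕ} (i j : Fin r) : ℕ → X r → ((Fin r → ℤ) → ℤ) → ℝ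
  | 0, s, G => if s.1 = G then 1 else 0
  | n + 1, s, G => ∑ a, p r a * hh i j n (st i j a s) G

theorem u_le_hh {r : ℕ} (i j : Fin r) (n : ℕ) (g : FreeGroup (Fin r)) (s : X r) :
    u (derivedSeries (FreeGroup (Fin r)) 2) n (QuotientGroup.mk g) ≤ hh i j n s ((rh i j g)⁻¹ s).1 := by
  classical
  induction n generalizing g s with
  | zero =>
    simp only [u, convPow, hh]
    by_cases h : (QuotientGroup.mk g : FreeGroup (Fin r) ⧸ derivedSeries (FreeGroup (Fin r)) 2) = 1
    · have := rh_ker i j g ((QuotientGroup.eq_one_iff g).1 h)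
      rw [if_pos h, this]; simp
    · rw [if_neg h]
      split_ifs <;> norm_num
  | succ n ih =>
    rw [u_succ]
    simp only [hh]
    refine Finset.sum_le_sum fun a _ => mul_le_mul_of_nonneg_left ?_ (p_nonneg a)
    have h1 := ih ((val a)⁻¹ * g) (st i j a s)
    rw [QuotientGroup.mk_mul, QuotientGroup.mk_inv] at h1
    refine h1.trans (le_of_eq ?_)
    congr 2
    rw [← rh_val i j a s, ← Equiv.Perm.mul_apply]
    simp

theorem hh_succ_le {r : ℕ} (hr : 2 ≤ r) (i j : Fin r) (n : ℕ) (b : ℝ) (h : ∀ s G, hh i j n s G ≤ b) :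
    ∀ s G, hh i j (n + 1) s G ≤ b := by
  intro s G
  simp only [hh]
  calc _ ≤ ∑ a, p r a * b := Finset.sum_le_sum fun a _ => mul_le_mul_of_nonneg_left (h _ _) (p_nonneg a)
    _ = b := by rw [← Finset.sum_mul, p_sum hr, one_mul]

theorem hh_add_le {r : ℕ} (hr : 2 ≤ r) (i j : Fin r) (n m : ℕ) (b : ℝ) (h : ∀ s G, hh i j n s G ≤ b) :
    ∀ s G, hh i j (n + m) s G ≤ b := by
  induction m with
  | zero => exact h
  | succ m ih => exact hh_succ_le hr i j _ b ih

/-- blocks of four steps -/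
abbrev W (r : ℕ) := S r × S r × S r × S r

/-- block weight -/
def p4 {r : ℕ} (w : W r) : ℝ := p r w.1 * (p r w.2.1 * (p r w.2.2.1 * p r w.2.2.2))

theorem p4_nonneg {r : ℕ} (w : W r) : 0 ≤ p4 w :=
  mul_nonneg (p_nonneg _) (mul_nonneg (p_nonneg _) (mul_nonneg (p_nonneg _) (p_nonneg _)))

/-- block displacement -/
def dl4 {r : ℕ} (w : W r) : Fin r → ℤ := dl w.1 + dl w.2.1 + dl w.2.2.1 + dl w.2.2.2

/-- block action -/
def st4 {r : ℕ} (i j : Fin r) (w : W r) (s : X r) : X r :=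
  st i j w.2.2.2 (st i j w.2.2.1 (st i j w.2.1 (st i j w.1 s)))

/-- configuration increment of a block -/
def ph4 {r : ℕ} (i j : Fin r) (w : W r) (x : Fin r → ℤ) : (Fin r → ℤ) → ℤ :=
  ph i j w.1 x + ph i j w.2.1 (x + dl w.1) + ph i j w.2.2.1 (x + dl w.1 + dl w.2.1)
    + ph i j w.2.2.2 (x + dl w.1 + dl w.2.1 + dl w.2.2.1)

theorem st4_eq {r : ℕ} (i j : Fin r) (w : W r) (s : X r) :
    st4 i j w s = (s.1 + ph4 i j w s.2, s.2 + dl4 w) := by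
  simp [st4, st, ph4, dl4, add_assoc]

/-- the commutator block -/
def cc {r : ℕ} (i j : Fin r) : W r := (some (i, true), some (j, true), some (i, false), some (j, false))
/-- the inverse commutator block -/
def cc' {r : ℕ} (i j : Fin r) : W r := (some (j, true), some (i, true), some (j, false), some (i, false))

theorem dl4_cc {r : ℕ} (i j : Fin r) : dl4 (cc i j) = 0 := by
  simp only [dl4, cc, dl]; abel

theorem dl4_cc' {r : ℕ} (i j : Fin r) : dl4 (cc' i j) = 0 := by
  simp only [dl4, cc', dl]; abel

open Classical in
theorem ph4_cc {r : ℕ} (i j : Fin r) (hij : i ≠ j) (x : Fin r → ℤ) : ph4 i j (cc i j) x = Pi.single x 1 := by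
  simp only [ph4, cc, ph, dl, if_neg hij, if_true]
  rw [H_diff, show x + Pi.single i 1 + Pi.single j 1 + -Pi.single i 1 - Pi.single j 1 = x by abel]
  abel

open Classical in
theorem ph4_cc' {r : ℕ} (i j : Fin r) (hij : i ≠ j) (x : Fin r → ℤ) : ph4 i j (cc' i j) x = -Pi.single x 1 := by
  simp only [ph4, cc', ph, dl, if_neg hij, if_true]
  rw [show x + Pi.single j 1 + Pi.single i 1 - Pi.single j 1 = x + Pi.single i 1 by abel, H_diff]
  abel

/-- coin blocks -/
def coin {r : ℕ} (i j : Fin r) (w : W r) : Prop := w = cc i j ∨ w = cc' i j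

open Classical in
/-- swap of the two coin blocks -/
def swp {r : ℕ} (i j : Fin r) : W r ≃ W r := Equiv.swap (cc i j) (cc' i j)

open Classical in
theorem swp_cc {r : ℕ} (i j : Fin r) : swp i j (cc i j) = cc' i j := Equiv.swap_apply_left _ _

open Classical in
theorem swp_cc' {r : ℕ} (i j : Fin r) : swp i j (cc' i j) = cc i j := Equiv.swap_apply_right _ _

open Classical in
theorem swp_ne {r : ℕ} (i j : Fin r) (w : W r) (h : ¬ coin i j w) : swp i j w = w :=
  Equiv.swap_apply_of_ne_of_ne (fun h' => h (Or.inl h')) (fun h' => h (Or.inr h'))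

theorem p4_swap {r : ℕ} (i j : Fin r) (w : W r) : p4 (swp i j w) = p4 w := by
  by_cases h : coin i j w
  · rcases h with h | h
    · subst h; rw [swp_cc]; simp [p4, cc, cc', p]
    · subst h; rw [swp_cc']; simp [p4, cc, cc', p]
  · rw [swp_ne i j w h]

theorem hh4 {r : ℕ} (i j : Fin r) (n : ℕ) (s : X r) (G : (Fin r → ℤ) → ℤ) :
    hh i j (n + 4) s G = ∑ w : W r, p4 w * hh i j n (st4 i j w s) G := by
  simp only [hh, Fintype.sum_prod_type, Finset.mul_sum, st4, p4, mul_assoc]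

open Classical in
/-- hitting probability with coins averaged -/
def hit {r : ℕ} (i j : Fin r) : List (W r) → X r → ((Fin r → ℤ) → ℤ) → ℝ
  | [], s, G => if s.1 = G then 1 else 0
  | w :: l, s, G => 1 / 2 * (hit i j l (st4 i j w s) G + hit i j l (st4 i j (swp i j w) s) G)

theorem hh_eq_hit {r : ℕ} (i j : Fin r) (J : ℕ) (s : X r) (G : (Fin r → ℤ) → ℤ) :
    hh i j (4 * J) s G = E p4 J (fun l => hit i j l s G) := by
  induction J generalizing s with
  | zero => simp [hh, E, hit]
  | succ J ih =>
    rw [show 4 * (J + 1) = 4 * J + 4 by ring, hh4]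
    simp only [E, hit, E_smul, E_add, ← ih]
    have h1 : ∑ w : W r, p4 w * hh i j (4 * J) (st4 i j w s) G =
      ∑ w : W r, p4 w * hh i j (4 * J) (st4 i j (swp i j w) s) G := by
      rw [← Equiv.sum_comp (swp i j) (fun w => p4 w * hh i j (4 * J) (st4 i j w s) G)]
      exact Finset.sum_congr rfl fun w _ => by rw [p4_swap]
    have h2 : ∀ a b c : ℝ, a * (1 / 2 * (b + c)) = 1 / 2 * (a * b) + 1 / 2 * (a * c) := by intros; ring
    simp only [h2, Finset.sum_add_distrib, ← Finset.mul_sum, ← h1]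
    ring

open Classical in
/-- coin counts -/
def Lc {r : ℕ} (i j : Fin r) : List (W r) → (Fin r → ℤ) → ((Fin r → ℤ) →₀ ℕ)
  | [], _ => 0
  | w :: l, x => (if coin i j w then Finsupp.single x 1 else 0) + Lc i j l (x + dl4 w)

open Classical in
/-- non-coin drift -/
def Dr {r : ℕ} (i j : Fin r) : List (W r) → (Fin r → ℤ) → ((Fin r → ℤ) → ℤ)
  | [], _ => 0
  | w :: l, x => (if coin i j w then 0 else ph4 i j w x) + Dr i j l (x + dl4 w)

/-- symmetric walk probabilities -/
def bt : ℕ → ℤ → ℝ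
  | 0, k => if k = 0 then 1 else 0
  | n + 1, k => 1 / 2 * (bt n (k - 1) + bt n (k + 1))

theorem bt_nonneg (n : ℕ) (k : ℤ) : 0 ≤ bt n k := by
  induction n generalizing k with
  | zero => simp only [bt]; split_ifs <;> norm_num
  | succ n ih => simp only [bt]; have := ih (k-1); have := ih (k+1); linarith

theorem bt_formula (n : ℕ) (k : ℤ) : (∀ j : ℕ, k = 2 * j - n → bt n k = n.choose j / 2 ^ n) ∧
    ((∀ j : ℕ, k ≠ 2 * j - n) → bt n k = 0) := by
  induction n generalizing k with
  | zero =>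
    constructor
    · intro j hj
      simp only [bt]
      rcases j with _ | j
      · simp [hj]
      · rw [if_neg (by push_cast at hj; omega)]; simp
    · intro h
      have := h 0
      simp only [bt]
      rw [if_neg (by simpa using this)]
  | succ n ih =>
    constructor
    · intro j hj
      simp only [bt]
      rw [(ih (k + 1)).1 j (by push_cast at hj; omega)]
      rcases j with _ | j
      · rw [(ih (k - 1)).2 (by intro j; push_cast at hj; omega)]
        simp [pow_succ]
        try ring
      · rw [(ih (k - 1)).1 j (by push_cast at hj; omega), Nat.choose_succ_succ]
        push_cast
        rw [pow_succ]; field_simp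
    · intro h
      simp only [bt]
      rw [(ih (k + 1)).2 (by intro j; have := h j; push_cast at this; omega),
        (ih (k - 1)).2 (by intro j; have := h (j + 1); push_cast at this; omega)]
      simp

theorem central_bound (m : ℕ) : m.centralBinom ^ 2 * (2 * m + 1) ≤ 16 ^ m := by
  induction m with
  | zero => simp
  | succ m ih =>
    have h := Nat.succ_mul_centralBinom_succ m
    have h2 : (m + 1) ^ 2 * ((m + 1).centralBinom ^ 2 * (2 * (m + 1) + 1)) ≤ (m + 1) ^ 2 * 16 ^ (m + 1) := by
      calc (m + 1) ^ 2 * ((m + 1).centralBinom ^ 2 * (2 * (m + 1) + 1))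
          = ((m + 1) * (m + 1).centralBinom) ^ 2 * (2 * m + 3) := by ring
        _ = (2 * (2 * m + 1) * m.centralBinom) ^ 2 * (2 * m + 3) := by rw [h]
        _ = (m.centralBinom ^ 2 * (2 * m + 1)) * (4 * ((2 * m + 1) * (2 * m + 3))) := by ring
        _ ≤ 16 ^ m * (4 * (4 * (m + 1) ^ 2)) := by
          refine Nat.mul_le_mul ih (Nat.mul_le_mul le_rfl ?_)
          nlinarith
        _ = (m + 1) ^ 2 * 16 ^ (m + 1) := by ring
    exact Nat.le_of_mul_le_mul_left h2 (by positivity)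

theorem middle_bound (n : ℕ) : (n.choose (n / 2)) ^ 2 * (n + 1) ≤ 4 ^ n := by
  rcases Nat.even_or_odd' n with ⟨m, rfl | rfl⟩
  · have := central_bound m
    rw [Nat.centralBinom_eq_two_mul_choose] at this
    rw [Nat.mul_div_cancel_left _ (by norm_num), pow_mul]
    exact this
  · have := central_bound (m + 1)
    rw [Nat.centralBinom_eq_two_mul_choose] at this
    have h2 : (2 * (m + 1)).choose (m + 1) = 2 * (2 * m + 1).choose m := by
      rw [show 2 * (m + 1) = (2 * m + 1) + 1 by ring, Nat.choose_succ_succ]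
      have : (2 * m + 1).choose (m.succ) = (2 * m + 1).choose m := Nat.choose_symm_half m
      rw [this]; ring
    rw [h2] at this
    rw [show (2 * m + 1) / 2 = m by omega]
    have h3 : (16:ℕ) ^ (m + 1) = 4 * 4 ^ (2 * m + 1) := by
      rw [show (16:ℕ) = 4 ^ 2 by norm_num, ← pow_mul, ← pow_succ']
      congr 1
    rw [h3] at this
    have h4 : 0 ≤ (2 * m + 1).choose m ^ 2 := by positivity
    nlinarith

theorem bt_le (n : ℕ) (k : ℤ) : bt n k ≤ (Real.sqrt (n + 1))⁻¹ := by
  by_cases h : ∃ j : ℕ, k = 2 * j - n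
  · obtain ⟨j, hj⟩ := h
    rw [(bt_formula n k).1 j hj]
    have h1 : (n.choose j : ℝ) ≤ n.choose (n / 2) := by exact_mod_cast Nat.choose_le_middle j n
    have h2 : ((n.choose (n / 2) : ℝ)) ^ 2 * (n + 1) ≤ (2 ^ n) ^ 2 := by
      have := middle_bound n
      rw [← pow_mul, mul_comm n 2, pow_mul]
      norm_num
      exact_mod_cast this
    have h3 : (n.choose (n / 2) : ℝ) * Real.sqrt (n + 1) ≤ 2 ^ n := by
      refine le_of_sq_le_sq ?_ (by positivity)
      rw [mul_pow, Real.sq_sqrt (by positivity)]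
      exact h2
    rw [div_le_iff₀ (by positivity), inv_mul_eq_div, le_div_iff₀ (by positivity)]
    exact (mul_le_mul_of_nonneg_right h1 (Real.sqrt_nonneg _)).trans h3
  · push Not at h
    rw [(bt_formula n k).2 h]
    positivity

end FM

namespace FM

theorem p4_sum {r : ℕ} (hr : 2 ≤ r) : ∑ w : W r, p4 w = 1 := by
  simp only [p4, Fintype.sum_prod_type, ← Finset.mul_sum, p_sum hr, mul_one]

theorem hit_cons_coin {r : ℕ} (i j : Fin r) (w : W r) (hw : coin i j w) (l : List (W r)) (s : X r)
    (G : (Fin r → ℤ) → ℤ) :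
    hit i j (w :: l) s G = 1 / 2 * (hit i j l (st4 i j (cc i j) s) G + hit i j l (st4 i j (cc' i j) s) G) := by
  rcases hw with rfl | rfl
  · simp only [hit, swp_cc]
  · simp only [hit, swp_cc']; ring

open Classical in
theorem hit_le_prod {r : ℕ} (i j : Fin r) (hij : i ≠ j) (B : Finset (Fin r → ℤ)) (l : List (W r)) (s : X r)
    (G : (Fin r → ℤ) → ℤ) :
    hit i j l s G ≤ ∏ z ∈ B, bt (Lc i j l s.2 z) ((G - s.1 - Dr i j l s.2) z) := by
  induction l generalizing s with
  | nil =>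
    simp only [hit, Lc, Dr]
    split_ifs with h
    · subst h; simp [bt]
    · exact Finset.prod_nonneg fun z _ => bt_nonneg _ _
  | cons w l ih =>
    by_cases hw : coin i j w
    · rw [hit_cons_coin i j w hw]
      have hd : dl4 w = 0 := by
        rcases hw with rfl | rfl
        · exact dl4_cc i j
        · exact dl4_cc' i j
      have h1 := ih (s.1 + Pi.single s.2 1, s.2)
      have h2 := ih (s.1 - Pi.single s.2 1, s.2)
      have e1 : st4 i j (cc i j) s = (s.1 + Pi.single s.2 1, s.2) := by
        rw [st4_eq, dl4_cc, ph4_cc i j hij, add_zero]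
      have e2 : st4 i j (cc' i j) s = (s.1 - Pi.single s.2 1, s.2) := by
        rw [st4_eq, dl4_cc', ph4_cc' i j hij, add_zero, sub_eq_add_neg]
      rw [e1, e2]
      simp only at h1 h2
      simp only [Lc, Dr, if_pos hw, hd, add_zero, zero_add]
      refine (mul_le_mul_of_nonneg_left (add_le_add h1 h2) (by norm_num)).trans (le_of_eq ?_)
      set L := Lc i j l s.2
      set D := Dr i j l s.2
      have off : ∀ (ε : ℤ) (z : Fin r → ℤ), z ≠ s.2 → (G - (s.1 + Pi.single s.2 ε) - D : (Fin r → ℤ) → ℤ) z = (G - s.1 - D) z := by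
        intro ε z hz
        simp [Pi.single_eq_of_ne hz]
      have e3 : s.1 - Pi.single s.2 1 = s.1 + Pi.single s.2 (-1) := by
        rw [Pi.single_neg, sub_eq_add_neg]
      rw [e3]
      have off2 : ∀ z : Fin r → ℤ, z ≠ s.2 → (Finsupp.single s.2 1 + L : (Fin r → ℤ) →₀ ℕ) z = L z := by
        intro z hz
        rw [Finsupp.add_apply, Finsupp.single_eq_of_ne hz, zero_add]
      by_cases hx : s.2 ∈ B
      · rw [← Finset.mul_prod_erase B _ hx, ← Finset.mul_prod_erase B _ hx, ← Finset.mul_prod_erase B _ hx]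
        have c1 : ∀ ε : ℤ, ∏ z ∈ B.erase s.2, bt (L z) ((G - (s.1 + Pi.single s.2 ε) - D : (Fin r → ℤ) → ℤ) z) =
            ∏ z ∈ B.erase s.2, bt (L z) ((G - s.1 - D) z) := fun ε =>
          Finset.prod_congr rfl fun z hz => by rw [off ε z (Finset.ne_of_mem_erase hz)]
        have c2 : ∏ z ∈ B.erase s.2, bt ((Finsupp.single s.2 1 + L : (Fin r → ℤ) →₀ ℕ) z) ((G - s.1 - D) z) =
            ∏ z ∈ B.erase s.2, bt (L z) ((G - s.1 - D) z) :=
          Finset.prod_congr rfl fun z hz => by rw [off2 z (Finset.ne_of_mem_erase hz)]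
        rw [c1, c1, c2, Finsupp.add_apply, Finsupp.single_eq_same, add_comm 1 (L s.2)]
        simp only [bt, Pi.sub_apply, Pi.add_apply, Pi.single_eq_same]
        rw [show G s.2 - (s.1 s.2 + 1) - D s.2 = G s.2 - s.1 s.2 - D s.2 - 1 by ring,
          show G s.2 - (s.1 s.2 + -1) - D s.2 = G s.2 - s.1 s.2 - D s.2 + 1 by ring]
        ring
      · have c1 : ∀ ε : ℤ, ∏ z ∈ B, bt (L z) ((G - (s.1 + Pi.single s.2 ε) - D : (Fin r → ℤ) → ℤ) z) =
            ∏ z ∈ B, bt (L z) ((G - s.1 - D) z) := fun ε =>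
          Finset.prod_congr rfl fun z hz => by rw [off ε z (fun h => hx (h ▸ hz))]
        have c2 : ∏ z ∈ B, bt ((Finsupp.single s.2 1 + L : (Fin r → ℤ) →₀ ℕ) z) ((G - s.1 - D) z) =
            ∏ z ∈ B, bt (L z) ((G - s.1 - D) z) :=
          Finset.prod_congr rfl fun z hz => by rw [off2 z (fun h => hx (h ▸ hz))]
        rw [c1, c1, c2]; ring
    · have h1 : hit i j (w :: l) s G = hit i j l (st4 i j w s) G := by
        simp only [hit, swp_ne i j w hw]; ring
      rw [h1]
      refine (ih _).trans (le_of_eq ?_)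
      rw [st4_eq]
      simp only [Lc, Dr, if_neg hw, zero_add]
      refine Finset.prod_congr rfl fun z _ => ?_
      congr 1
      simp only [Pi.sub_apply, Pi.add_apply]; ring

theorem hit_le {r : ℕ} (i j : Fin r) (hij : i ≠ j) (l : List (W r)) (s : X r)
    (G : (Fin r → ℤ) → ℤ) :
    hit i j l s G ≤ ∏ z ∈ (Lc i j l s.2).support, (Real.sqrt ((Lc i j l s.2 z : ℝ) + 1))⁻¹ :=
  (hit_le_prod i j hij _ l s G).trans (Finset.prod_le_prod (fun _ _ => bt_nonneg _ _) fun _ _ => bt_le _ _)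

theorem hit_le_one {r : ℕ} (i j : Fin r) (hij : i ≠ j) (l : List (W r)) (s : X r)
    (G : (Fin r → ℤ) → ℤ) : hit i j l s G ≤ 1 := by
  have := hit_le_prod i j hij ∅ l s G
  simpa using this

/-- projection to the torus -/
def pi {r : ℕ} (m : ℕ) (x : Fin r → ℤ) : Fin r → ZMod m := fun k => (x k : ZMod m)

theorem pi_add {r : ℕ} (m : ℕ) (x y : Fin r → ℤ) : pi m (x + y) = pi m x + pi m y := by
  funext k; simp [pi]

open Classical in
/-- coins outside `D` -/
def T {r m : ℕ} (i j : Fin r) (D : Finset (Fin r → ZMod m)) : List (W r) → (Fin r → ZMod m) → ℕ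
  | [], _ => 0
  | w :: l, y => (if coin i j w ∧ y ∉ D then 1 else 0) + T i j D l (y + pi m (dl4 w))

open Classical in
theorem T_eq {r m : ℕ} (i j : Fin r) (D : Finset (Fin r → ZMod m)) (l : List (W r)) (x : Fin r → ℤ) :
    T i j D l (pi m x) = (Lc i j l x).sum fun z k => if pi m z ∈ D then 0 else k := by
  induction l generalizing x with
  | nil => simp [T, Lc]
  | cons w l ih =>
    simp only [T, Lc]
    rw [Finsupp.sum_add_index' (by intro a; simp) (by intro a b c; split_ifs <;> simp), ← pi_add, ih]
    congr 1
    by_cases hw : coin i j w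
    · by_cases hx : pi m x ∈ D <;> simp [hw, hx]
    · simp [hw]

open Classical in
theorem hit_cases {r m : ℕ} [NeZero m] (i j : Fin r) (hij : i ≠ j) (Q K θ : ℝ) (hQ : 1 ≤ Q) (hθ : 0 ≤ θ) (l : List (W r))
    (s : X r) (G : (Fin r → ℤ) → ℤ) :
    hit i j l s G ≤ Real.exp (-(Real.log Q / 4 * (m:ℝ) ^ r)) + Real.exp (-(Real.log 2 / 2 * K)) +
      ∑ D ∈ (Finset.univ : Finset (Finset (Fin r → ZMod m))).filter (fun D => 2 * D.card ≤ m ^ r),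
        Real.exp (θ * (Q * K)) * Real.exp (-(θ * T i j D l (pi m s.2))) := by
  have hs : 0 ≤ ∑ D ∈ (Finset.univ : Finset (Finset (Fin r → ZMod m))).filter (fun D => 2 * D.card ≤ m ^ r),
        Real.exp (θ * (Q * K)) * Real.exp (-(θ * T i j D l (pi m s.2))) :=
    Finset.sum_nonneg fun _ _ => by positivity
  have h0 := hit_le i j hij l s G
  set L := Lc i j l s.2 with hL
  set A := L.support.filter (fun z => Q ≤ L z) with hA
  have e1 := Real.exp_pos (-(Real.log Q / 4 * (m:ℝ) ^ r))
  have e2 := Real.exp_pos (-(Real.log 2 / 2 * K))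
  have key : ∀ (a : ℝ), 1 ≤ a → ∀ B ⊆ L.support, (∀ z ∈ B, a ≤ (L z : ℝ) + 1) →
      hit i j l s G ≤ Real.exp (-(Real.log a / 2 * B.card)) := by
    intro a ha B hB hz
    have f1 : ∀ c : ℝ, 1 ≤ c → (Real.sqrt c)⁻¹ = Real.exp (-(Real.log c / 2)) := by
      intro c hc
      rw [Real.exp_neg, ← Real.log_sqrt (by linarith), Real.exp_log (Real.sqrt_pos.2 (by linarith))]
    refine h0.trans ?_
    calc ∏ z ∈ L.support, (Real.sqrt ((L z : ℝ) + 1))⁻¹ ≤ ∏ z ∈ B, (Real.sqrt ((L z : ℝ) + 1))⁻¹ := by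
          rw [← Finset.prod_sdiff hB]
          refine mul_le_of_le_one_left (Finset.prod_nonneg fun _ _ => by positivity)
            (Finset.prod_le_one (fun _ _ => by positivity) fun z _ => ?_)
          apply inv_le_one_of_one_le₀
          rw [Real.one_le_sqrt]
          have : (0:ℝ) ≤ L z := by positivity
          linarith
      _ ≤ ∏ z ∈ B, Real.exp (-(Real.log a / 2)) := by
          refine Finset.prod_le_prod (fun _ _ => by positivity) fun z hzB => ?_
          rw [← f1 a ha]
          have := hz z hzB
          gcongr
      _ = Real.exp (-(Real.log a / 2 * B.card)) := by
          rw [Finset.prod_const, ← Real.exp_nat_mul]; congr 1; ring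
  by_cases c1 : m ^ r ≤ 2 * A.card
  · have h1 := key Q hQ A (Finset.filter_subset _ _) (fun z hz => by
      have := (Finset.mem_filter.1 hz).2; linarith)
    have h2 : Real.exp (-(Real.log Q / 2 * A.card)) ≤ Real.exp (-(Real.log Q / 4 * (m:ℝ) ^ r)) := by
      apply Real.exp_le_exp.2
      have h3 : ((m:ℝ) ^ r) ≤ 2 * A.card := by exact_mod_cast c1
      have := Real.log_nonneg hQ
      nlinarith
    linarith
  by_cases c2 : K ≤ L.support.card
  · have h1 := key 2 (by norm_num) L.support le_rfl (fun z hz => by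
      have : 1 ≤ L z := Nat.one_le_iff_ne_zero.2 (Finsupp.mem_support_iff.1 hz)
      have : (1:ℝ) ≤ L z := by exact_mod_cast this
      linarith)
    have h2 : Real.exp (-(Real.log 2 / 2 * L.support.card)) ≤ Real.exp (-(Real.log 2 / 2 * K)) := by
      apply Real.exp_le_exp.2
      have := Real.log_nonneg (show (1:ℝ) ≤ 2 by norm_num)
      nlinarith
    linarith
  · have hT : (T i j (A.image (pi m)) l (pi m s.2) : ℝ) ≤ Q * K := by
      rw [T_eq, ← hL, Finsupp.sum, Nat.cast_sum]
      calc _ ≤ ∑ z ∈ L.support, Q := by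
            refine Finset.sum_le_sum fun z hz => ?_
            split_ifs with hzD
            · simp; linarith
            · by_contra hc
              exact hzD (Finset.mem_image_of_mem _ (Finset.mem_filter.2 ⟨hz, by linarith⟩))
        _ = L.support.card * Q := by rw [Finset.sum_const, nsmul_eq_mul]
        _ ≤ Q * K := by rw [mul_comm]; apply mul_le_mul_of_nonneg_left <;> linarith
    have h1 : hit i j l s G ≤ 1 := hit_le_one i j hij l s G
    have h2 : (1:ℝ) ≤ Real.exp (θ * (Q * K)) * Real.exp (-(θ * T i j (A.image (pi m)) l (pi m s.2))) := by
      rw [← Real.exp_add]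
      apply Real.one_le_exp
      nlinarith
    have h3 := Finset.single_le_sum (f := fun D => Real.exp (θ * (Q * K)) * Real.exp (-(θ * T i j D l (pi m s.2))))
      (s := (Finset.univ : Finset (Finset (Fin r → ZMod m))).filter (fun D => 2 * D.card ≤ m ^ r))
      (fun _ _ => by positivity) (a := A.image (pi m)) (Finset.mem_filter.2 ⟨Finset.mem_univ _, by
        have := Finset.card_image_le (s := A) (f := pi m)
        omega⟩)
    linarith

open Classical in
/-- killed transfer operator -/
def Kop {r m : ℕ} (i j : Fin r) (θ : ℝ) (D : Finset (Fin r → ZMod m)) (f : (Fin r → ZMod m) → ℝ) :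
    (Fin r → ZMod m) → ℝ := fun y =>
  ∑ w : W r, p4 w * ((if coin i j w ∧ y ∉ D then Real.exp (-θ) else 1) * f (y + pi m (dl4 w)))

open Classical in
theorem E_T {r m : ℕ} (i j : Fin r) (θ : ℝ) (D : Finset (Fin r → ZMod m)) (J : ℕ) (y : Fin r → ZMod m) :
    E p4 J (fun l => Real.exp (-(θ * T i j D l y))) = (Kop i j θ D)^[J] 1 y := by
  induction J generalizing y with
  | zero => simp [E, T]
  | succ J ih =>
    rw [Function.iterate_succ_apply']
    simp only [E, T, Kop]
    refine Finset.sum_congr rfl fun w _ => ?_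
    rw [← ih, ← E_smul (n := J) (c := if coin i j w ∧ y ∉ D then Real.exp (-θ) else 1)]
    congr 2
    funext l
    split_ifs with h
    · rw [← Real.exp_add]; congr 1; push_cast; ring
    · simp

end FM

namespace FM

/-- discrete torus -/
abbrev Tor (r m : ℕ) := Fin r → ZMod m

section spectral
variable {r m : ℕ} [NeZero m]

/-- squared norm -/
def N2 (f : Tor r m → ℝ) : ℝ := ∑ x, f x ^ 2

/-- inner product -/
def ip (f g : Tor r m → ℝ) : ℝ := ∑ x, f x * g x

/-- averaging operator -/
def Pop (f : Tor r m → ℝ) : Tor r m → ℝ := fun y => ∑ a, p r a * f (y + pi m (dl a))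

theorem ip_self (f : Tor r m → ℝ) : ip f f = N2 f := by
  simp only [ip, N2, sq]

theorem ip_comm (f g : Tor r m → ℝ) : ip f g = ip g f := by
  simp only [ip, mul_comm]

theorem N2_nonneg (f : Tor r m → ℝ) : 0 ≤ N2 f := Finset.sum_nonneg fun _ _ => sq_nonneg _

theorem pi_dl_inv (a : S r) : pi m (dl (inv a)) = -pi m (dl a) := by
  rcases a with _ | ⟨k, _ | _⟩ <;> · funext x; simp [inv, dl, pi]

theorem sum_shift (f : Tor r m → ℝ) (h : Tor r m) : ∑ x, f (x + h) = ∑ x, f x :=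
  Equiv.sum_comp (Equiv.addRight h) f

theorem Pop_symm (f g : Tor r m → ℝ) : ip (Pop f) g = ip f (Pop g) := by
  have h1 : ip (Pop f) g = ∑ a, p r a * ∑ x, f (x + pi m (dl a)) * g x := by
    simp only [ip, Pop, Finset.sum_mul, Finset.mul_sum]
    rw [Finset.sum_comm]
    simp only [mul_assoc]
  have h2 : ip f (Pop g) = ∑ a, p r a * ∑ x, f x * g (x + pi m (dl a)) := by
    simp only [ip, Pop, Finset.mul_sum]
    rw [Finset.sum_comm]
    exact Finset.sum_congr rfl fun a _ => Finset.sum_congr rfl fun x _ => by ring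
  rw [h1, h2, ← sum_inv]
  refine Finset.sum_congr rfl fun a _ => ?_
  congr 1
  rw [← sum_shift _ (pi m (dl a))]
  refine Finset.sum_congr rfl fun x _ => ?_
  rw [pi_dl_inv]; simp

theorem Pop4 (f : Tor r m → ℝ) (y : Tor r m) :
    ∑ w : W r, p4 w * f (y + pi m (dl4 w)) = Pop (Pop (Pop (Pop f))) y := by
  simp only [Pop, p4, dl4, Fintype.sum_prod_type, Finset.mul_sum, pi_add, add_assoc, mul_assoc]

/-- Dirichlet form -/
def Dir (f : Tor r m → ℝ) : ℝ := ∑ i : Fin r, ∑ x, (f (x + Pi.single i 1) - f x) ^ 2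

theorem Dir_nonneg (f : Tor r m → ℝ) : 0 ≤ Dir f :=
  Finset.sum_nonneg fun _ _ => Finset.sum_nonneg fun _ _ => sq_nonneg _

theorem pi_dl_true (k : Fin r) : pi m (dl (some (k, true))) = Pi.single k 1 := by
  funext x
  by_cases h : x = k
  · subst h; simp [dl, pi]
  · simp [dl, pi, Pi.single_eq_of_ne h]

theorem N2_Pop (hr : 2 ≤ r) (f : Tor r m → ℝ) : N2 (Pop f) ≤ N2 f - 1 / (8 * r) * Dir f := by
  have hr0 : (0:ℝ) < r := by exact_mod_cast (by omega : 0 < r)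
  set e : Fin r × Bool → Tor r m := fun a => pi m (dl (some a)) with he
  have h1 : ∀ y, Pop f y = ∑ a : Fin r × Bool, (1 / (2 * r) : ℝ) * ((f y + f (y + e a)) / 2) := by
    intro y
    simp only [Pop, Fintype.sum_option]
    have h0 : pi m (dl (none : S r)) = 0 := by funext x; simp [dl, pi]
    rw [h0, add_zero]
    have : ∀ a : Fin r × Bool, (1 / (2 * r) : ℝ) * ((f y + f (y + e a)) / 2) =
      1 / (4 * r) * f y + p r (some a) * f (y + e a) := by
      intro a; simp only [p]; field_simp; ring
    simp only [this, Finset.sum_add_distrib, Finset.sum_const, Finset.card_univ, Fintype.card_prod, Fintype.card_fin,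
      Fintype.card_bool, nsmul_eq_mul]
    congr 1
    simp only [p]; push_cast; field_simp; ring
  have h2 : ∀ y, (Pop f y) ^ 2 ≤ ∑ a : Fin r × Bool, (1 / (2 * r) : ℝ) *
      ((f y ^ 2 + f (y + e a) ^ 2) / 2 - (f (y + e a) - f y) ^ 2 / 4) := by
    intro y
    rw [h1]
    refine (sq_sum_le_card_mul_sum_sq).trans (le_of_eq ?_)
    rw [Finset.mul_sum]
    refine Finset.sum_congr rfl fun a _ => ?_
    simp only [Finset.card_univ, Fintype.card_prod, Fintype.card_fin, Fintype.card_bool]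
    push_cast; field_simp; ring
  have h3 : N2 (Pop f) ≤ ∑ a : Fin r × Bool, (1 / (2 * r) : ℝ) * (N2 f - (∑ y, (f (y + e a) - f y) ^ 2) / 4) := by
    refine (Finset.sum_le_sum fun y _ => h2 y).trans (le_of_eq ?_)
    rw [Finset.sum_comm]
    refine Finset.sum_congr rfl fun a _ => ?_
    rw [← Finset.mul_sum, Finset.sum_sub_distrib, ← Finset.sum_div, ← Finset.sum_div, Finset.sum_add_distrib,
      sum_shift (fun x => f x ^ 2) (e a)]
    simp only [N2]; ring
  refine h3.trans ?_
  rw [← Finset.mul_sum, Finset.sum_sub_distrib, ← Finset.sum_div]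
  have h4 : Dir f ≤ ∑ a : Fin r × Bool, ∑ y, (f (y + e a) - f y) ^ 2 := by
    rw [Fintype.sum_prod_type]
    refine Finset.sum_le_sum fun i _ => ?_
    rw [Fintype.sum_bool, he]
    simp only [pi_dl_true]
    have : 0 ≤ ∑ y, (f (y + pi m (dl (some (i, false)))) - f y) ^ 2 := Finset.sum_nonneg fun _ _ => sq_nonneg _
    linarith
  simp only [Finset.sum_const, Finset.card_univ, Fintype.card_prod, Fintype.card_fin, Fintype.card_bool, nsmul_eq_mul]
  push_cast
  have h5 : (1 / (8 * r) : ℝ) * Dir f ≤ 1 / (8 * r) * ∑ a : Fin r × Bool, ∑ y, (f (y + e a) - f y) ^ 2 := by gcongr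
  have h6 : (1 / (2 * r) : ℝ) * (r * 2 * N2 f - (∑ a : Fin r × Bool, ∑ y, (f (y + e a) - f y) ^ 2) / 4) =
    N2 f - 1 / (8 * r) * ∑ a : Fin r × Bool, ∑ y, (f (y + e a) - f y) ^ 2 := by field_simp; ring
  linarith

/-- translation modulus -/
def sN (f : Tor r m → ℝ) (h : Tor r m) : ℝ := ‖(WithLp.toLp 2 (fun x => f (x + h) - f x) : EuclideanSpace ℝ (Tor r m))‖

theorem sN_sq (f : Tor r m → ℝ) (h : Tor r m) : sN f h ^ 2 = ∑ x, (f (x + h) - f x) ^ 2 := by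
  simp [sN, EuclideanSpace.norm_sq_eq]

theorem sN_nonneg (f : Tor r m → ℝ) (h : Tor r m) : 0 ≤ sN f h := norm_nonneg _

theorem sN_zero (f : Tor r m → ℝ) : sN f 0 = 0 := by
  have := sN_sq f 0
  simpa using this

theorem sN_add (f : Tor r m → ℝ) (h k : Tor r m) : sN f (h + k) ≤ sN f h + sN f k := by
  have h1 : ‖(WithLp.toLp 2 (fun x => f (x + h + k) - f (x + h)) : EuclideanSpace ℝ (Tor r m))‖ = sN f k := by
    rw [← sq_eq_sq₀ (norm_nonneg _) (sN_nonneg _ _), sN_sq, EuclideanSpace.norm_sq_eq]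
    simp only [Real.norm_eq_abs, sq_abs]
    exact sum_shift (fun x => (f (x + k) - f x) ^ 2) h
  rw [← h1]
  refine le_trans (le_of_eq ?_) (norm_add_le _ _)
  simp only [sN]
  congr 1
  ext x
  simp [add_assoc]

theorem sN_nsmul (f : Tor r m → ℝ) (h : Tor r m) (k : ℕ) : sN f (k • h) ≤ k * sN f h := by
  induction k with
  | zero => simp [sN_zero]
  | succ k ih =>
    rw [succ_nsmul]
    refine (sN_add _ _ _).trans ?_
    push_cast; linarith

theorem sN_le (f : Tor r m → ℝ) (h : Tor r m) : sN f h ^ 2 ≤ r * (m:ℝ) ^ 2 * Dir f := by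
  have h0 : h = ∑ i : Fin r, (h i).val • (Pi.single i 1 : Tor r m) := by
    funext k
    rw [Finset.sum_apply, Finset.sum_eq_single k]
    · simp
    · intro b _ hb; simp [Pi.single_eq_of_ne hb.symm]
    · simp
  have h1 : sN f h ≤ ∑ i : Fin r, m * sN f (Pi.single i 1) := by
    conv_lhs => rw [h0]
    refine (Finset.le_sum_of_subadditive (sN f) (sN_zero f).le (sN_add f) _ _).trans (Finset.sum_le_sum fun i _ => ?_)
    refine (sN_nsmul _ _ _).trans ?_
    refine mul_le_mul_of_nonneg_right ?_ (sN_nonneg _ _)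
    exact_mod_cast (ZMod.val_lt (h i)).le
  have h2 : sN f h ^ 2 ≤ (∑ i : Fin r, m * sN f (Pi.single i 1)) ^ 2 := by
    have := sN_nonneg f h
    gcongr
  refine h2.trans (sq_sum_le_card_mul_sum_sq.trans (le_of_eq ?_))
  simp only [mul_pow, sN_sq, Finset.card_univ, Fintype.card_fin, ← Finset.mul_sum, Dir]
  ring

open Classical in
/-- restriction to the complement -/
def res (D : Finset (Tor r m)) (f : Tor r m → ℝ) : Tor r m → ℝ := fun x => if x ∈ D then 0 else f x

open Classical in
theorem poincare (D : Finset (Tor r m)) (hD : 2 * D.card ≤ m ^ r) (f : Tor r m → ℝ) :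
    N2 f ≤ 4 * N2 (res D f) + 4 * (r * (m:ℝ) ^ 2 * Dir f) := by
  have hcard : Fintype.card (Tor r m) = m ^ r := by simp [ZMod.card]
  set M : ℝ := (m:ℝ) ^ r with hM
  have hMpos : 0 < M := by
    have : 0 < m := Nat.pos_of_ne_zero (NeZero.ne m)
    positivity
  have h1 : ∀ x y, f x ^ 2 * (if y ∈ D then 0 else 1) ≤ 2 * res D f y ^ 2 + 2 * (f y - f x) ^ 2 := by
    intro x y
    simp only [res]
    split_ifs
    · nlinarith [sq_nonneg (f y - f x)]
    · nlinarith [sq_nonneg (2 * f y - f x)]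
  have h2 : ∑ x, ∑ y, f x ^ 2 * (if y ∈ D then (0:ℝ) else 1) ≤ ∑ x, ∑ y, (2 * res D f y ^ 2 + 2 * (f y - f x) ^ 2) :=
    Finset.sum_le_sum fun x _ => Finset.sum_le_sum fun y _ => h1 x y
  have h3 : ∑ x, ∑ y, f x ^ 2 * (if y ∈ D then (0:ℝ) else 1) = N2 f * (M - D.card) := by
    simp only [← Finset.mul_sum, ← Finset.sum_mul, N2]
    congr 1
    have : ∀ y, (if y ∈ D then (0:ℝ) else 1) = 1 - (if y ∈ D then 1 else 0) := by intro y; split_ifs <;> simp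
    simp only [this, Finset.sum_sub_distrib, Finset.sum_const, Finset.card_univ, hcard]
    simp [hM]
  have h4 : ∑ x, ∑ y, (2 * res D f y ^ 2 + 2 * (f y - f x) ^ 2) = 2 * M * N2 (res D f) + 2 * ∑ h, sN f h ^ 2 := by
    simp only [Finset.sum_add_distrib, ← Finset.mul_sum, N2]
    congr 1
    · simp [hcard, hM]; ring
    · congr 1
      simp only [sN_sq]
      rw [Finset.sum_comm (γ := Tor r m) (f := fun h x => (f (x + h) - f x) ^ 2)]
      refine Finset.sum_congr rfl fun x _ => ?_
      exact (Equiv.sum_comp (Equiv.addLeft x) (fun y => (f y - f x) ^ 2)).symm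
  have h5 : ∑ h, sN f h ^ 2 ≤ M * (r * (m:ℝ) ^ 2 * Dir f) := by
    refine (Finset.sum_le_sum fun h _ => sN_le f h).trans (le_of_eq ?_)
    simp [hcard, hM]
  have h6 : 2 * (D.card : ℝ) ≤ M := by rw [hM]; exact_mod_cast hD
  have h7 := N2_nonneg f
  rw [h3, h4] at h2
  have h8 : M * N2 f ≤ M * (4 * N2 (res D f) + 4 * (r * (m:ℝ) ^ 2 * Dir f)) := by nlinarith
  exact le_of_mul_le_mul_left h8 hMpos

open Classical in
theorem Kop_eq (hr : 2 ≤ r) (i j : Fin r) (hij : i ≠ j) (θ : ℝ) (D : Finset (Tor r m)) (f : Tor r m → ℝ) (y : Tor r m) :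
    Kop i j θ D f y = Pop (Pop (Pop (Pop f))) y - 2 * (1 / (4 * r)) ^ 4 * (1 - Real.exp (-θ)) * res D f y := by
  have hne : cc i j ≠ cc' i j := by simp [cc, cc', hij]
  have h0 : pi m (0 : Fin r → ℤ) = 0 := by funext x; simp [pi]
  rw [← Pop4]
  simp only [Kop, res]
  by_cases hy : y ∈ D
  · simp [hy]
  · simp only [hy, not_false_eq_true, and_true, if_false]
    have h1 : ∀ w : W r, p4 w * ((if coin i j w then Real.exp (-θ) else 1) * f (y + pi m (dl4 w))) =
        p4 w * f (y + pi m (dl4 w)) - (if w ∈ ({cc i j, cc' i j} : Finset (W r)) then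
          (1 / (4 * r)) ^ 4 * (1 - Real.exp (-θ)) * f y else 0) := by
      intro w
      by_cases hw : coin i j w
      · rw [if_pos hw, if_pos (by simpa [coin] using hw)]
        rcases hw with rfl | rfl
        · rw [dl4_cc, h0, add_zero]; simp only [p4, cc, p]; ring
        · rw [dl4_cc', h0, add_zero]; simp only [p4, cc', p]; ring
      · rw [if_neg hw, if_neg (by simpa [coin] using hw)]; ring
    rw [Finset.sum_congr rfl fun w _ => h1 w, Finset.sum_sub_distrib]
    rw [Finset.sum_ite_mem, Finset.univ_inter, Finset.sum_const, Finset.card_pair hne, nsmul_eq_mul]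
    push_cast; ring

theorem Kop_lin (i j : Fin r) (θ : ℝ) (D : Finset (Tor r m)) (f g : Tor r m → ℝ) (t : ℝ) :
    Kop i j θ D (f + t • g) = Kop i j θ D f + t • Kop i j θ D g := by
  funext y
  simp only [Kop, Pi.add_apply, Pi.smul_apply, smul_eq_mul, Finset.mul_sum, ← Finset.sum_add_distrib]
  exact Finset.sum_congr rfl fun w _ => by ring

open Classical in
theorem Kop_ip (hr : 2 ≤ r) (i j : Fin r) (hij : i ≠ j) (θ : ℝ) (D : Finset (Tor r m)) (f g : Tor r m → ℝ) :
    ip (Kop i j θ D f) g = ip (Pop (Pop f)) (Pop (Pop g))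
      - 2 * (1 / (4 * r)) ^ 4 * (1 - Real.exp (-θ)) * ip (res D f) (res D g) := by
  rw [← Pop_symm, ← Pop_symm]
  simp only [ip, Kop_eq hr i j hij, sub_mul, Finset.sum_sub_distrib, Finset.mul_sum]
  congr 1
  refine Finset.sum_congr rfl fun x _ => ?_
  simp only [res]
  split_ifs <;> ring

open Classical in
theorem N2_res (D : Finset (Tor r m)) (f : Tor r m → ℝ) : N2 (res D f) ≤ N2 f := by
  refine Finset.sum_le_sum fun x _ => ?_
  simp only [res]
  split_ifs
  · nlinarith [sq_nonneg (f x)]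
  · exact le_rfl

theorem Kop_norm (hr : 2 ≤ r) (i j : Fin r) (hij : i ≠ j) (θ κ : ℝ) (hθ : 0 ≤ θ) (hκ : 0 < κ)
    (h1 : 4 * κ ≤ 2 * (1 / (4 * r)) ^ 4 * (1 - Real.exp (-θ))) (h2 : 32 * (r:ℝ) ^ 2 * (m:ℝ) ^ 2 * κ ≤ 1)
    (D : Finset (Tor r m)) (hD : 2 * D.card ≤ m ^ r) (f : Tor r m → ℝ) :
    N2 (Kop i j θ D f) ≤ (1 - κ) ^ 2 * N2 f := by
  have hr2 : (2:ℝ) ≤ r := by exact_mod_cast hr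
  have hm1 : (1:ℝ) ≤ m := by exact_mod_cast Nat.pos_of_ne_zero (NeZero.ne m)
  set c : ℝ := 2 * (1 / (4 * r)) ^ 4 * (1 - Real.exp (-θ)) with hc
  have hc1 : c ≤ 1 / 2 := by
    have a1 : (1 / (4 * r) : ℝ) ≤ 1 / 2 := one_div_le_one_div_of_le (by norm_num) (by linarith)
    have a2 : (1 / (4 * r) : ℝ) ^ 4 ≤ (1 / 2) ^ 4 := pow_le_pow_left₀ (by positivity) a1 4
    have a3 := Real.exp_pos (-θ)
    have a4 : 0 ≤ (1 / (4 * r) : ℝ) ^ 4 := by positivity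
    rw [hc]; nlinarith
  have hκ2 : κ ≤ 1 / 2 := by linarith
  have up : ∀ g : Tor r m → ℝ, ip (Kop i j θ D g) g ≤ (1 - κ) * N2 g := by
    intro g
    rw [Kop_ip hr i j hij, ← hc, ip_self, ip_self]
    have b1 := N2_Pop hr (Pop g)
    have b2 := N2_Pop hr g
    have b3 := Dir_nonneg (Pop g)
    have b4 := poincare D hD g
    have b5 := N2_nonneg (res D g)
    have b6 := Dir_nonneg g
    have b7 : 0 ≤ 1 / (8 * (r:ℝ)) * Dir (Pop g) := by positivity
    have b8 : 4 * (r * (m:ℝ) ^ 2 * Dir g) * κ ≤ 1 / (8 * r) * Dir g := by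
      have : 4 * (r * (m:ℝ) ^ 2) * κ ≤ 1 / (8 * r) := by
        rw [le_div_iff₀ (by positivity)]; nlinarith
      nlinarith
    nlinarith
  have lo : ∀ g : Tor r m → ℝ, -((1 - κ) * N2 g) ≤ ip (Kop i j θ D g) g := by
    intro g
    rw [Kop_ip hr i j hij, ← hc, ip_self, ip_self]
    have b1 := N2_nonneg (Pop (Pop g))
    have b2 := N2_res D g
    have b3 := N2_nonneg (res D g)
    have b4 : 0 ≤ c := by linarith
    nlinarith
  set g := Kop i j θ D f with hg
  set t : ℝ := 1 / (1 - κ) with ht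
  have hρ : 0 < 1 - κ := by linarith
  have e1 : ip (Kop i j θ D (f + t • g)) (f + t • g) - ip (Kop i j θ D (f + (-t) • g)) (f + (-t) • g) =
      4 * t * N2 g := by
    have s1 : ip (Kop i j θ D g) f = ip g g := by
      conv_rhs => rw [hg, ← hg]
      have : ip (Kop i j θ D g) f = ip (Kop i j θ D f) g := by
        rw [Kop_ip hr i j hij, Kop_ip hr i j hij, ip_comm (Pop (Pop g)), ip_comm (res D g)]
      rw [this]
    rw [Kop_lin, Kop_lin, ← hg, ← ip_self g]
    have s2 : ∀ (a b c d : Tor r m → ℝ) (t : ℝ), ip (a + t • b) (c + t • d) - ip (a + (-t) • b) (c + (-t) • d) =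
        2 * t * (ip a d + ip b c) := by
      intro a b c d t
      simp only [ip, Pi.add_apply, Pi.smul_apply, smul_eq_mul, ← Finset.sum_sub_distrib, ← Finset.sum_add_distrib,
        Finset.mul_sum]
      exact Finset.sum_congr rfl fun x _ => by ring
    rw [s2, s1]; ring
  have e2 : N2 (f + t • g) + N2 (f + (-t) • g) = 2 * (N2 f + t ^ 2 * N2 g) := by
    simp only [N2, Pi.add_apply, Pi.smul_apply, smul_eq_mul, ← Finset.sum_add_distrib, Finset.mul_sum]
    exact Finset.sum_congr rfl fun x _ => by ring
  have e3 := up (f + t • g)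
  have e4 := lo (f + (-t) • g)
  have e5 : 4 * t * N2 g ≤ 2 * (1 - κ) * (N2 f + t ^ 2 * N2 g) := by nlinarith
  have e6 : (1 - κ) * t = 1 := by rw [ht]; field_simp
  have e7 : (1 - κ) * (4 * t * N2 g) ≤ (1 - κ) * (2 * (1 - κ) * (N2 f + t ^ 2 * N2 g)) :=
    mul_le_mul_of_nonneg_left e5 hρ.le
  have e8 : (1 - κ) * (4 * t * N2 g) = 4 * N2 g := by linear_combination 4 * N2 g * e6
  have e9 : (1 - κ) * (2 * (1 - κ) * (N2 f + t ^ 2 * N2 g)) = 2 * (1 - κ) ^ 2 * N2 f + 2 * N2 g := by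
    linear_combination 2 * N2 g * ((1 - κ) * t + 1) * e6
  linarith

theorem spec (hr : 2 ≤ r) (i j : Fin r) (hij : i ≠ j) (θ κ : ℝ) (hθ : 0 ≤ θ) (hκ : 0 < κ) (hκ1 : κ ≤ 1)
    (h1 : 4 * κ ≤ 2 * (1 / (4 * r)) ^ 4 * (1 - Real.exp (-θ))) (h2 : 32 * (r:ℝ) ^ 2 * (m:ℝ) ^ 2 * κ ≤ 1)
    (D : Finset (Tor r m)) (hD : 2 * D.card ≤ m ^ r) (J : ℕ) (y : Tor r m) :
    (Kop i j θ D)^[J] 1 y ≤ (1 - κ) ^ J * (m:ℝ) ^ r := by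
  have hm1 : (1:ℝ) ≤ m := by exact_mod_cast Nat.pos_of_ne_zero (NeZero.ne m)
  have h3 : N2 ((Kop i j θ D)^[J] 1) ≤ ((1 - κ) ^ J) ^ 2 * (m:ℝ) ^ r := by
    induction J with
    | zero => simp [N2, ZMod.card]
    | succ J ih =>
      rw [Function.iterate_succ_apply']
      refine (Kop_norm hr i j hij θ κ hθ hκ h1 h2 D hD _).trans ?_
      calc _ ≤ (1 - κ) ^ 2 * (((1 - κ) ^ J) ^ 2 * (m:ℝ) ^ r) := mul_le_mul_of_nonneg_left ih (sq_nonneg _)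
        _ = _ := by ring
  have h4 : ((Kop i j θ D)^[J] 1 y) ^ 2 ≤ N2 ((Kop i j θ D)^[J] 1) :=
    Finset.single_le_sum (f := fun x => ((Kop i j θ D)^[J] 1 x) ^ 2) (fun _ _ => sq_nonneg _) (Finset.mem_univ y)
  have h5 : 0 ≤ (1 - κ) ^ J := pow_nonneg (by linarith) _
  have h6 : (1:ℝ) ≤ (m:ℝ) ^ r := one_le_pow₀ hm1
  refine le_of_sq_le_sq ?_ (by positivity)
  refine h4.trans (h3.trans ?_)
  rw [mul_pow]
  refine mul_le_mul_of_nonneg_left ?_ (by positivity)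
  nlinarith

end spectral

end FM

namespace FM

open Classical in
theorem upper_main {r : ℕ} (hr : 2 ≤ r) (m J n : ℕ) [NeZero m] (hJ : 4 * J ≤ 2 * n) (Q K θ κ : ℝ) (hQ : 1 ≤ Q)
    (hθ : 0 ≤ θ) (hκ : 0 < κ) (hκ1 : κ ≤ 1)
    (h1 : 4 * κ ≤ 2 * (1 / (4 * r)) ^ 4 * (1 - Real.exp (-θ))) (h2 : 32 * (r:ℝ) ^ 2 * (m:ℝ) ^ 2 * κ ≤ 1) :
    u (derivedSeries (FreeGroup (Fin r)) 2) (2 * n) 1 ≤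
      Real.exp (-(Real.log Q / 4 * (m:ℝ) ^ r)) + Real.exp (-(Real.log 2 / 2 * K)) +
      2 ^ (m ^ r) * (Real.exp (θ * (Q * K)) * ((1 - κ) ^ J * (m:ℝ) ^ r)) := by
  let i : Fin r := ⟨0, by omega⟩
  let j : Fin r := ⟨1, by omega⟩
  have hij : i ≠ j := by simp [i, j]
  obtain ⟨k, hk⟩ := Nat.exists_eq_add_of_le hJ
  have h3 := u_le_hh i j (2 * n) 1 (0, 0)
  rw [QuotientGroup.mk_one] at h3
  refine h3.trans ?_
  rw [hk]
  refine hh_add_le hr i j (4 * J) k _ (fun s G => ?_) _ _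
  rw [hh_eq_hit]
  refine (E_mono p4_nonneg J fun l _ => hit_cases (m := m) i j hij Q K θ hQ hθ l s G).trans ?_
  rw [E_add, E_const (p4_sum hr), E_sum]
  refine add_le_add le_rfl ?_
  calc _ ≤ ∑ D ∈ (Finset.univ : Finset (Finset (Fin r → ZMod m))).filter (fun D => 2 * D.card ≤ m ^ r),
        Real.exp (θ * (Q * K)) * ((1 - κ) ^ J * (m:ℝ) ^ r) := by
        refine Finset.sum_le_sum fun D hD => ?_
        rw [E_smul, E_T]
        exact mul_le_mul_of_nonneg_left (spec hr i j hij θ κ hθ hκ hκ1 h1 h2 D (Finset.mem_filter.1 hD).2 J _)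
          (Real.exp_pos _).le
    _ ≤ _ := by
        rw [Finset.sum_const, nsmul_eq_mul]
        refine mul_le_mul_of_nonneg_right ?_ (by
          have : 0 ≤ (1 - κ) ^ J := pow_nonneg (by linarith) _
          positivity)
        have : (Finset.univ : Finset (Finset (Fin r → ZMod m))).card = 2 ^ (m ^ r) := by
          rw [Finset.card_univ, Fintype.card_finset]; simp [ZMod.card]
        have h4 := Finset.card_filter_le (Finset.univ : Finset (Finset (Fin r → ZMod m))) (fun D => 2 * D.card ≤ m ^ r)
        rw [this] at h4
        exact_mod_cast h4

open Classical in
theorem small_main {r : ℕ} (hr : 2 ≤ r) : ∃ ρ : ℝ, 0 < ρ ∧ ρ < 1 ∧ ∀ n : ℕ, 2 ≤ n →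
    u (derivedSeries (FreeGroup (Fin r)) 2) (2 * n) 1 ≤ ρ := by
  let i : Fin r := ⟨0, by omega⟩
  let j : Fin r := ⟨1, by omega⟩
  have hij : i ≠ j := by simp [i, j]
  have hr0 : (0:ℝ) < r := by exact_mod_cast (by omega : 0 < r)
  have hp : 0 < p4 (cc i j) := by simp only [p4, cc, p]; positivity
  have hp1 : p4 (cc i j) ≤ 1 := by
    rw [← p4_sum hr]
    exact Finset.single_le_sum (fun w _ => p4_nonneg w) (Finset.mem_univ _)
  have key : ∀ s G, hh i j 4 s G ≤ 1 - p4 (cc i j) * (1 / 4) := by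
    intro s G
    have := hh_eq_hit i j 1 s G
    rw [mul_one] at this
    rw [this]
    simp only [E]
    obtain ⟨g, hg1, hg2⟩ : ∃ g : W r → ℝ, g (cc i j) = p4 (cc i j) * (1 / 4) ∧ ∀ w, w ≠ cc i j → g w = 0 :=
      ⟨fun w => if w = cc i j then p4 w * (1 / 4) else 0, if_pos rfl, fun w hw => if_neg hw⟩
    have h1 : ∀ w : W r, p4 w * hit i j [w] s G ≤ p4 w - g w := by
      intro w
      by_cases h : w = cc i j
      · subst h
        rw [hg1]
        have h2 := hit_le i j hij [cc i j] s G
        have h3 : Lc i j [cc i j] s.2 = Finsupp.single s.2 1 := by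
          simp [Lc, coin]
        rw [h3, Finsupp.support_single _ one_ne_zero, Finset.prod_singleton, Finsupp.single_eq_same] at h2
        have h4 : (Real.sqrt (((1:ℕ):ℝ) + 1))⁻¹ ≤ 3 / 4 := by
          rw [inv_le_comm₀ (by positivity) (by norm_num)]
          apply Real.le_sqrt_of_sq_le
          norm_num
        have h5 := mul_le_mul_of_nonneg_left (h2.trans h4) hp.le
        linarith
      · rw [hg2 w h]
        have := mul_le_mul_of_nonneg_left (hit_le_one i j hij [w] s G) (p4_nonneg w)
        linarith
    refine (Finset.sum_le_sum fun w _ => h1 w).trans (le_of_eq ?_)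
    rw [Finset.sum_sub_distrib, p4_sum hr, Finset.sum_eq_single (cc i j) (fun w _ hw => hg2 w hw)
      (fun h => absurd (Finset.mem_univ _) h), hg1]
  refine ⟨1 - p4 (cc i j) * (1 / 4), by linarith, by linarith, fun n hn => ?_⟩
  have h3 := u_le_hh i j (2 * n) 1 (0, 0)
  rw [QuotientGroup.mk_one] at h3
  refine h3.trans ?_
  obtain ⟨k, hk⟩ := Nat.exists_eq_add_of_le (show 4 ≤ 2 * n by omega)
  rw [hk]
  exact hh_add_le hr i j 4 k _ key _ _

/-- the rate -/
def Xr (r n : ℕ) : ℝ := (n : ℝ) ^ ((r : ℝ) / ((r : ℝ) + 2)) * (Real.log n) ^ ((2 : ℝ) / ((r : ℝ) + 2))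

theorem params {r n : ℕ} (hn : 2 ≤ n) : ∃ R : ℝ, 1 ≤ R ∧ R ^ r * Real.log n = Xr r n ∧ Xr r n * R ^ 2 = n ∧
    (n:ℝ) ^ (1 / ((r:ℝ) + 2)) =
      Real.exp ((2 * Real.log (Real.log n) - Real.log n) / (r + 2)) * R ^ 2 := by
  have hn' : (2:ℝ) ≤ n := by exact_mod_cast hn
  have hn0 : (0:ℝ) < n := by linarith
  have hL : 0 < Real.log n := Real.log_pos (by linarith)
  have hd : (0:ℝ) < (r:ℝ) + 2 := by positivity
  set a := Real.log n with ha
  set b := Real.log a with hb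
  have hX : Xr r n = Real.exp (r * a / (r + 2) + 2 * b / (r + 2)) := by
    rw [Xr, Real.rpow_def_of_pos hn0, ← ha, Real.rpow_def_of_pos hL, ← hb, ← Real.exp_add]
    congr 1; ring
  have hba : b ≤ a := (Real.log_le_sub_one_of_pos hL).trans (by linarith)
  refine ⟨Real.exp ((a - b) / (r + 2)), Real.one_le_exp (div_nonneg (by linarith) hd.le), ?_, ?_, ?_⟩
  · rw [hX, ← Real.exp_nat_mul]
    nth_rewrite 2 [← Real.exp_log hL]
    rw [← Real.exp_add, ← hb]
    congr 1; field_simp; ring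
  · rw [hX, ← Real.exp_nat_mul, ← Real.exp_add]
    conv_rhs => rw [← Real.exp_log hn0, ← ha]
    congr 1; push_cast; field_simp; ring
  · rw [Real.rpow_def_of_pos hn0, ← ha, ← Real.exp_nat_mul, ← Real.exp_add]
    congr 1; push_cast; field_simp; ring

theorem lower_final {r : ℕ} (hr : 2 ≤ r) : ∃ C : ℝ, 1 ≤ C ∧ ∀ n : ℕ, 2 ≤ n →
    Real.exp (-(C * Xr r n)) ≤ u (derivedSeries (FreeGroup (Fin r)) 2) (2 * n) 1 := by
  refine ⟨4 + 3 * r * 5 ^ r + 2 * 5 ^ r, by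
    have : (0:ℝ) ≤ 3 * r * 5 ^ r := by positivity
    have : (0:ℝ) ≤ 2 * 5 ^ r := by positivity
    linarith, fun n hn => ?_⟩
  obtain ⟨R0, hR0, hX1, hX2, -⟩ := params (r := r) hn
  set X := Xr r n
  have hn' : (2:ℝ) ≤ n := by exact_mod_cast hn
  have hlog2 : 1 / 2 ≤ Real.log 2 := by have := Real.log_two_gt_d9; linarith
  have hL : 1 / 2 ≤ Real.log n := hlog2.trans (Real.log_le_log (by norm_num) hn')
  set R := ⌈R0⌉₊ with hRdef
  have hR1 : R0 ≤ R := Nat.le_ceil _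
  have hR2 : (R:ℝ) ≤ 2 * R0 := by
    have := Nat.ceil_lt_add_one (show 0 ≤ R0 by linarith)
    linarith
  have hR : 1 ≤ R := by
    have : (1:ℝ) ≤ R := by linarith
    exact_mod_cast this
  have hR' : (1:ℝ) ≤ R := by exact_mod_cast hR
  have hm := lower_main hr R hR n
  set U := u (derivedSeries (FreeGroup (Fin r)) 2) (2 * n) 1
  have hU : 0 ≤ U := u_nonneg _ _ _
  have h5 : (2 * R + 1 : ℝ) ^ r ≤ 5 ^ r * R0 ^ r := by
    rw [← mul_pow]; exact pow_le_pow_left₀ (by positivity) (by linarith) r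
  have hX0 : 0 ≤ X := by rw [← hX1]; positivity
  have hRX : R0 ^ r ≤ 2 * X := by
    rw [← hX1]
    have : 0 ≤ R0 ^ r := by positivity
    nlinarith
  have d1 : (2 * n + 1 : ℝ) ^ ((2 * R + 1) ^ r * r) ≤ Real.exp (3 * r * 5 ^ r * X) := by
    have e1 : (2 * n + 1 : ℝ) ≤ Real.exp (3 * Real.log n) := by
      rw [show (3:ℝ) * Real.log n = ((3:ℕ):ℝ) * Real.log n by norm_num, Real.exp_nat_mul, Real.exp_log (by linarith)]
      nlinarith [sq_nonneg (n - 2 : ℝ), mul_self_nonneg (n:ℝ)]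
    calc (2 * n + 1 : ℝ) ^ ((2 * R + 1) ^ r * r) ≤ Real.exp (3 * Real.log n) ^ ((2 * R + 1) ^ r * r) :=
          pow_le_pow_left₀ (by positivity) e1 _
      _ = Real.exp (((2 * R + 1) ^ r * r) * (3 * Real.log n)) := by
          rw [← Real.exp_nat_mul]; push_cast; rfl
      _ ≤ _ := by
          apply Real.exp_le_exp.2
          rw [← hX1]
          calc ((2 * R + 1 : ℝ) ^ r * r) * (3 * Real.log n) ≤ ((5 ^ r * R0 ^ r) * r) * (3 * Real.log n) := by gcongr
            _ = _ := by ring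
  have d2 : (2 * R + 1 : ℝ) ^ r ≤ Real.exp (2 * 5 ^ r * X) := by
    refine h5.trans (le_trans ?_ (Real.add_one_le_exp _))
    have : (0:ℝ) ≤ 5 ^ r := by positivity
    nlinarith
  have d3 : Real.exp (-(4 * X)) ≤ ((1 + Real.cos (Real.pi / (2 * R))) / 2) ^ (2 * n) := by
    set y := Real.pi ^ 2 / (16 * (R:ℝ) ^ 2) with hy
    have hpi : Real.pi ^ 2 ≤ 10 := by
      have := Real.pi_lt_d2
      have := Real.pi_pos
      nlinarith
    have hy0 : 0 ≤ y := by positivity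
    have hy1 : y ≤ 5 / 8 := by
      rw [hy, div_le_iff₀ (by positivity)]
      nlinarith
    have c1 : 1 - y ≤ (1 + Real.cos (Real.pi / (2 * R))) / 2 := by
      have := Real.one_sub_sq_div_two_le_cos (x := Real.pi / (2 * R))
      have e : (Real.pi / (2 * R)) ^ 2 / 2 = 2 * y := by rw [hy]; field_simp; norm_num
      rw [e] at this
      linarith
    have c2 : Real.exp (-(3 * y)) ≤ 1 - y := by
      rw [Real.exp_neg, inv_le_comm₀ (Real.exp_pos _) (by linarith)]
      refine le_trans ?_ (Real.add_one_le_exp _)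
      rw [inv_le_iff_one_le_mul₀ (by linarith)]
      nlinarith
    calc Real.exp (-(4 * X)) ≤ Real.exp (-(3 * y)) ^ (2 * n) := by
          rw [← Real.exp_nat_mul]
          apply Real.exp_le_exp.2
          push_cast
          have e1 : y * R0 ^ 2 ≤ 10 / 16 := by
            rw [hy, div_mul_eq_mul_div, div_le_iff₀ (by positivity)]
            have : R0 ^ 2 ≤ (R:ℝ) ^ 2 := by gcongr
            have := sq_nonneg R0
            nlinarith
          rw [← hX2]
          nlinarith
      _ ≤ (1 - y) ^ (2 * n) := pow_le_pow_left₀ (Real.exp_pos _).le c2 _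
      _ ≤ _ := pow_le_pow_left₀ (by linarith) c1 _
  have d4 : Real.exp (-(4 * X)) ≤ Real.exp (3 * r * 5 ^ r * X) * Real.exp (2 * 5 ^ r * X) * U := by
    refine (d3.trans hm).trans ?_
    gcongr
  have d5 : Real.exp (-((4 + 3 * r * 5 ^ r + 2 * 5 ^ r) * X)) =
      Real.exp (-(4 * X)) * (Real.exp (3 * r * 5 ^ r * X) * Real.exp (2 * 5 ^ r * X))⁻¹ := by
    rw [← Real.exp_add, ← Real.exp_neg, ← Real.exp_add]; congr 1; ring
  rw [d5, mul_inv_le_iff₀ (by positivity)]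
  linarith

end FM

namespace FM

theorem exp_aux (θ : ℝ) (hθ0 : 0 < θ) (hθ1 : θ ≤ 1) : θ / 2 ≤ 1 - Real.exp (-θ) := by
  have h1 : Real.exp (-θ) ≤ 1 / (1 + θ) := by
    rw [Real.exp_neg, ← one_div]
    apply one_div_le_one_div_of_le (by positivity)
    linarith [Real.add_one_le_exp θ]
  have h2 : 1 / (1 + θ) ≤ 1 - θ / 2 := by
    rw [div_le_iff₀ (by positivity)]; nlinarith
  linarith

set_option maxHeartbeats 4000000 in
theorem upper_large {r : ℕ} (hr : 2 ≤ r) : ∃ M : ℝ, ∀ n : ℕ, 2 ≤ n → M ≤ Real.log n →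
    u (derivedSeries (FreeGroup (Fin r)) 2) (2 * n) 1 ≤ Real.exp (-(1 / (2048 * (r:ℝ) ^ 2) * Xr r n)) := by
  have hr2 : (2:ℝ) ≤ r := by exact_mod_cast hr
  have hr4 : (4:ℝ) ≤ (r:ℝ) ^ 2 := by nlinarith
  have hr5 : (r:ℝ) ≤ (r:ℝ) ^ 2 := by nlinarith
  set η : ℝ := (1 / (4 * r)) ^ 4 with hη
  have hη0 : 0 < η := by positivity
  set cθ : ℝ := 1 / (8 * (r:ℝ) ^ 2 * η) with hcθ
  have hcθ0 : 0 < cθ := by positivity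
  -- thresholds
  set M1 : ℝ := 2 * 2 ^ r * (2048 * (r:ℝ) ^ 2) with hM1
  set M2 : ℝ := cθ * (2048 * (r:ℝ) ^ 2) with hM2
  have hM20 : 0 < M2 := by positivity
  set M3 : ℝ := 2048 * (r:ℝ) ^ 2 * 2 with hM3
  refine ⟨max M1 (max M3 (2 * ((r + 2) * M2 + 4))), fun n hn hlog => ?_⟩
  have hl1 : M1 ≤ Real.log n := (le_max_left _ _).trans hlog
  have hl3 : M3 ≤ Real.log n := ((le_max_left _ _).trans (le_max_right _ _)).trans hlog
  have hl2 : 2 * ((r + 2) * M2 + 4) ≤ Real.log n := ((le_max_right _ _).trans (le_max_right _ _)).trans hlog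
  obtain ⟨R0, hR0, hX1, hX2, hX3⟩ := params (r := r) hn
  set X := Xr r n
  have hn' : (2:ℝ) ≤ n := by exact_mod_cast hn
  set a := Real.log n with ha
  have hM10 : 0 < M1 := by positivity
  have ha0 : 0 < a := by linarith
  have hRr : 1 ≤ R0 ^ r := one_le_pow₀ hR0
  have hXa : a ≤ X := by rw [← hX1]; exact le_mul_of_one_le_left ha0.le hRr
  have hX0 : 0 < X := by linarith
  set ε := Real.exp ((2 * Real.log a - a) / (r + 2)) with hε
  have hε1 : cθ * ε ≤ 1 / (2048 * (r:ℝ) ^ 2) := by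
    have h1 : Real.log a ≤ a / 8 + 2 := by
      have := Real.log_le_sub_one_of_pos (show 0 < a / 8 by positivity)
      rw [Real.log_div (by positivity) (by norm_num)] at this
      have h8 : Real.log 8 ≤ 3 := by
        rw [show (8:ℝ) = 2 ^ 3 by norm_num, Real.log_pow]
        have := Real.log_two_lt_d9
        norm_num; linarith
      linarith
    have h2 : ε ≤ 1 / M2 := by
      have h3 : (2 * Real.log a - a) / (r + 2) ≤ -M2 := by
        rw [div_le_iff₀ (by positivity)]
        linarith
      refine (Real.exp_le_exp.2 h3).trans ?_
      rw [Real.exp_neg, ← one_div]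
      apply one_div_le_one_div_of_le hM20
      linarith [Real.add_one_le_exp M2]
    calc cθ * ε ≤ cθ * (1 / M2) := by gcongr
      _ = _ := by rw [hM2]; field_simp
  set m := ⌈R0⌉₊ with hm
  have hm1 : R0 ≤ m := Nat.le_ceil _
  have hm2 : (m:ℝ) ≤ 2 * R0 := by
    have := Nat.ceil_lt_add_one (show 0 ≤ R0 by linarith)
    linarith
  have hm0 : (1:ℝ) ≤ m := by linarith
  have : NeZero m := ⟨by rintro h; rw [h] at hm0; norm_num at hm0⟩
  set Q : ℝ := (n:ℝ) ^ (1 / ((r:ℝ) + 2)) with hQ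
  have hQ1 : 1 ≤ Q := Real.one_le_rpow (by linarith) (by positivity)
  set κ : ℝ := 1 / (32 * (r:ℝ) ^ 2 * (m:ℝ) ^ 2) with hκ
  have hκ0 : 0 < κ := by positivity
  set θ : ℝ := cθ / (m:ℝ) ^ 2 with hθ
  have hθ0 : 0 < θ := by positivity
  have hmR : R0 ^ 2 ≤ (m:ℝ) ^ 2 := by gcongr
  have hθQ : θ * Q ≤ 1 / (2048 * (r:ℝ) ^ 2) := by
    rw [hX3, hθ]
    refine le_trans ?_ hε1
    rw [div_mul_eq_mul_div, div_le_iff₀ (by positivity)]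
    rw [← mul_assoc]
    exact mul_le_mul_of_nonneg_left hmR (by positivity)
  have hsm : 1 / (2048 * (r:ℝ) ^ 2) ≤ 1 := by
    rw [div_le_one (by positivity)]; linarith
  have hθ1 : θ ≤ 1 := (le_mul_of_one_le_right hθ0.le hQ1).trans (hθQ.trans hsm)
  have hexp : θ / 2 ≤ 1 - Real.exp (-θ) := exp_aux θ hθ0 hθ1
  have hk1 : 4 * κ ≤ 2 * (1 / (4 * r)) ^ 4 * (1 - Real.exp (-θ)) := by
    rw [← hη]
    have : 4 * κ = 2 * η * (θ / 2) := by rw [hκ, hθ, hcθ]; field_simp; norm_num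
    rw [this]; gcongr
  have hk2 : 32 * (r:ℝ) ^ 2 * (m:ℝ) ^ 2 * κ ≤ 1 := by rw [hκ]; apply le_of_eq; field_simp
  have hκ1 : κ ≤ 1 := by
    have : 1 ≤ 32 * (r:ℝ) ^ 2 * (m:ℝ) ^ 2 := by
      have h1 : 1 ≤ (m:ℝ) ^ 2 := one_le_pow₀ hm0
      have h2 := mul_le_mul hr4 h1 (by norm_num) (by positivity)
      linarith
    rw [hκ, div_le_one (by positivity)]; exact this
  have main := upper_main hr m (n / 2) n (by omega) Q X θ κ hQ1 hθ0.le hκ0 hκ1 hk1 hk2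
  refine main.trans ?_
  set c : ℝ := 1 / (1024 * (r:ℝ) ^ 2) with hc
  have t1 : Real.exp (-(Real.log Q / 4 * (m:ℝ) ^ r)) ≤ Real.exp (-(c * X)) := by
    apply Real.exp_le_exp.2
    apply neg_le_neg
    have h1 : Real.log Q = 1 / ((r:ℝ) + 2) * a := by rw [hQ, Real.log_rpow (by linarith)]
    have h2 : R0 ^ r ≤ (m:ℝ) ^ r := by gcongr
    rw [h1, ← hX1]
    have h3 : c ≤ 1 / ((r:ℝ) + 2) / 4 := by
      rw [hc, div_div]
      apply one_div_le_one_div_of_le (by positivity)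
      linarith
    calc c * (R0 ^ r * a) ≤ (1 / ((r:ℝ) + 2) / 4) * ((m:ℝ) ^ r * a) := by gcongr
      _ = _ := by ring
  have t2 : Real.exp (-(Real.log 2 / 2 * X)) ≤ Real.exp (-(c * X)) := by
    apply Real.exp_le_exp.2
    apply neg_le_neg
    have h1 := Real.log_two_gt_d9
    have h2 : c ≤ 1 / 4 := by
      rw [hc]; apply one_div_le_one_div_of_le (by norm_num); linarith
    apply mul_le_mul_of_nonneg_right _ hX0.le
    linarith
  have t3 : 2 ^ (m ^ r) * (Real.exp (θ * (Q * X)) * ((1 - κ) ^ (n / 2) * (m:ℝ) ^ r)) ≤ Real.exp (-(c * X)) := by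
    have s1 : (2:ℝ) ^ (m ^ r) ≤ Real.exp ((m:ℝ) ^ r) := by
      calc (2:ℝ) ^ (m ^ r) ≤ (Real.exp 1) ^ (m ^ r) := by
            have := Real.add_one_le_exp (1:ℝ)
            gcongr; linarith
        _ = _ := by rw [← Real.exp_nat_mul]; push_cast; rw [mul_one]
    have s2 : (m:ℝ) ^ r ≤ Real.exp ((m:ℝ) ^ r) := by linarith [Real.add_one_le_exp ((m:ℝ) ^ r)]
    have s3 : (1 - κ) ^ (n / 2) ≤ Real.exp (-(κ * (n / 2 : ℕ))) := by
      have : 1 - κ ≤ Real.exp (-κ) := by linarith [Real.add_one_le_exp (-κ)]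
      refine (pow_le_pow_left₀ (by linarith) this _).trans (le_of_eq ?_)
      rw [← Real.exp_nat_mul]; congr 1; ring
    have s4 : X / (512 * (r:ℝ) ^ 2) ≤ κ * (n / 2 : ℕ) := by
      have h1 : (n:ℝ) / 4 ≤ ((n / 2 : ℕ) : ℝ) := by
        have : n ≤ 4 * (n / 2) := by omega
        have : (n:ℝ) ≤ 4 * ((n / 2 : ℕ) : ℝ) := by exact_mod_cast this
        linarith
      have h2 : 1 / (128 * (r:ℝ) ^ 2 * R0 ^ 2) ≤ κ := by
        rw [hκ]
        apply one_div_le_one_div_of_le (by positivity)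
        have : (m:ℝ) ^ 2 ≤ (2 * R0) ^ 2 := by gcongr
        have := mul_le_mul_of_nonneg_left this (show 0 ≤ 32 * (r:ℝ) ^ 2 by positivity)
        linarith
      calc X / (512 * (r:ℝ) ^ 2) = 1 / (128 * (r:ℝ) ^ 2 * R0 ^ 2) * (n / 4) := by
            rw [← hX2]; field_simp; norm_num
        _ ≤ _ := by gcongr
    have s5 : (m:ℝ) ^ r + (m:ℝ) ^ r ≤ 1 / (2048 * (r:ℝ) ^ 2) * X := by
      have h1 : (m:ℝ) ^ r ≤ 2 ^ r * R0 ^ r := by rw [← mul_pow]; gcongr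
      have h2 : R0 ^ r * M1 ≤ X := by rw [← hX1]; gcongr
      have h3 : 1 / (2048 * (r:ℝ) ^ 2) * (R0 ^ r * M1) = 2 * (2 ^ r * R0 ^ r) := by
        rw [hM1]; field_simp
      have h4 : 1 / (2048 * (r:ℝ) ^ 2) * (R0 ^ r * M1) ≤ 1 / (2048 * (r:ℝ) ^ 2) * X := by gcongr
      linarith
    have s6 : θ * (Q * X) ≤ 1 / (2048 * (r:ℝ) ^ 2) * X := by
      rw [← mul_assoc]; gcongr
    calc _ ≤ Real.exp ((m:ℝ) ^ r) * (Real.exp (θ * (Q * X)) * (Real.exp (-(κ * (n / 2 : ℕ))) * Real.exp ((m:ℝ) ^ r))) := by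
          have : 0 ≤ (1 - κ) ^ (n / 2) := pow_nonneg (by linarith) _
          gcongr
      _ = Real.exp (((m:ℝ) ^ r + (m:ℝ) ^ r) + θ * (Q * X) - κ * (n / 2 : ℕ)) := by
          rw [← Real.exp_add, ← Real.exp_add, ← Real.exp_add]; congr 1; ring
      _ ≤ _ := by
          apply Real.exp_le_exp.2
          have : X / (512 * (r:ℝ) ^ 2) = c * X + (1 / (2048 * (r:ℝ) ^ 2) * X + 1 / (2048 * (r:ℝ) ^ 2) * X) := by
            rw [hc]; field_simp; norm_num
          linarith
  have hcX : c * X = 1 / (2048 * (r:ℝ) ^ 2) * X + 1 / (2048 * (r:ℝ) ^ 2) * X := by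
    rw [hc]; field_simp; norm_num
  have h3 : 3 * Real.exp (-(1 / (2048 * (r:ℝ) ^ 2) * X)) ≤ 1 := by
    have h4 : 2 ≤ 1 / (2048 * (r:ℝ) ^ 2) * X := by
      rw [one_div, inv_mul_eq_div, le_div_iff₀ (by positivity)]
      linarith
    have h5 := Real.add_one_le_exp (1 / (2048 * (r:ℝ) ^ 2) * X)
    rw [Real.exp_neg, ← div_eq_mul_inv, div_le_one (Real.exp_pos _)]
    linarith
  have h6 : Real.exp (-(c * X)) = Real.exp (-(1 / (2048 * (r:ℝ) ^ 2) * X)) * Real.exp (-(1 / (2048 * (r:ℝ) ^ 2) * X)) := by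
    rw [← Real.exp_add, hcX]; congr 1; ring
  have h7 := mul_le_mul_of_nonneg_left h3 (Real.exp_pos (-(1 / (2048 * (r:ℝ) ^ 2) * X))).le
  linarith

theorem upper_final {r : ℕ} (hr : 2 ≤ r) : ∃ c : ℝ, 0 < c ∧ ∀ n : ℕ, 2 ≤ n →
    u (derivedSeries (FreeGroup (Fin r)) 2) (2 * n) 1 ≤ Real.exp (-(c * Xr r n)) := by
  have hr2 : (2:ℝ) ≤ r := by exact_mod_cast hr
  obtain ⟨M, hM⟩ := upper_large hr
  obtain ⟨ρ, hρ0, hρ1, hρ⟩ := small_main hr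
  have hlρ : 0 < -Real.log ρ := by have := Real.log_neg hρ0 hρ1; linarith
  set B := Real.exp M
  have hB : 0 < B := Real.exp_pos _
  refine ⟨min (1 / (2048 * (r:ℝ) ^ 2)) (-Real.log ρ / B), by positivity, fun n hn => ?_⟩
  obtain ⟨R0, hR0, hX1, hX2, -⟩ := params (r := r) hn
  have hn' : (2:ℝ) ≤ n := by exact_mod_cast hn
  have hX0 : 0 ≤ Xr r n := by
    rw [← hX1]
    have := Real.log_nonneg (show (1:ℝ) ≤ n by linarith)
    positivity
  by_cases h : M ≤ Real.log n
  · refine (hM n hn h).trans (Real.exp_le_exp.2 (neg_le_neg ?_))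
    exact mul_le_mul_of_nonneg_right (min_le_left _ _) hX0
  · push Not at h
    have h1 : (n:ℝ) < B := (Real.log_lt_iff_lt_exp (by linarith)).1 h
    have h2 : Xr r n ≤ B := by
      have : 1 ≤ R0 ^ 2 := one_le_pow₀ hR0
      nlinarith
    refine (hρ n hn).trans ?_
    rw [← Real.exp_log hρ0]
    apply Real.exp_le_exp.2
    rw [Real.exp_log hρ0]
    have h3 : min (1 / (2048 * (r:ℝ) ^ 2)) (-Real.log ρ / B) * Xr r n ≤ (-Real.log ρ / B) * B :=
      mul_le_mul (min_le_right _ _) h2 hX0 (by positivity)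
    rw [div_mul_cancel₀ _ hB.ne'] at h3
    linarith

theorem final {r : ℕ} (hr : 2 ≤ r) : ∃ C : ℝ, 1 ≤ C ∧ ∀ n : ℕ, 2 ≤ n →
      Real.exp (-C * (n : ℝ) ^ ((r : ℝ) / ((r : ℝ) + 2)) *
          (Real.log n) ^ ((2 : ℝ) / ((r : ℝ) + 2)))
        ≤ convPow (lazySRWQuot r (derivedSeries (FreeGroup (Fin r)) 2)) (2 * n) 1 ∧
      convPow (lazySRWQuot r (derivedSeries (FreeGroup (Fin r)) 2)) (2 * n) 1
        ≤ Real.exp (-(1 / C) * (n : ℝ) ^ ((r : ℝ) / ((r : ℝ) + 2)) *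
          (Real.log n) ^ ((2 : ℝ) / ((r : ℝ) + 2))) := by
  obtain ⟨C1, hC1, h1⟩ := lower_final hr
  obtain ⟨c, hc, h2⟩ := upper_final hr
  refine ⟨max C1 (1 / c), hC1.trans (le_max_left _ _), fun n hn => ?_⟩
  have hX0 : 0 ≤ Xr r n := by
    have hn' : (2:ℝ) ≤ n := by exact_mod_cast hn
    have := Real.log_nonneg (show (1:ℝ) ≤ n by linarith)
    rw [Xr]; positivity
  have e : ∀ t : ℝ, -t * (n : ℝ) ^ ((r : ℝ) / ((r : ℝ) + 2)) * (Real.log n) ^ ((2 : ℝ) / ((r : ℝ) + 2)) =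
      -(t * Xr r n) := by intro t; rw [Xr]; ring
  rw [e, e]
  constructor
  · refine le_trans (Real.exp_le_exp.2 (neg_le_neg ?_)) (h1 n hn)
    exact mul_le_mul_of_nonneg_right (le_max_left _ _) hX0
  · refine (h2 n hn).trans (Real.exp_le_exp.2 (neg_le_neg ?_))
    refine mul_le_mul_of_nonneg_right ?_ hX0
    rw [one_div_le (by positivity) hc]
    exact le_max_right _ _

end FM

/-- Theorem (Saloff-Coste–Zheng): return probability of the lazy simple random walk on the
free metabelian group `S_{2,r} = F_r / [[F_r,F_r],[F_r,F_r]]`, `r ≥ 2`: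
`μ^{(2n)}(e) ≍ exp(− n^{r/(r+2)} (log n)^{2/(r+2)})`. -/
theorem return_probability_free_metabelian (r : ℕ) (hr : 2 ≤ r) :
    ∃ C : ℝ, 1 ≤ C ∧ ∀ n : ℕ, 2 ≤ n →
      Real.exp (-C * (n : ℝ) ^ ((r : ℝ) / ((r : ℝ) + 2)) *
          (Real.log n) ^ ((2 : ℝ) / ((r : ℝ) + 2)))
        ≤ convPow (lazySRWQuot r (derivedSeries (FreeGroup (Fin r)) 2)) (2 * n) 1 ∧
      convPow (lazySRWQuot r (derivedSeries (FreeGroup (Fin r)) 2)) (2 * n) 1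
        ≤ Real.exp (-(1 / C) * (n : ℝ) ^ ((r : ℝ) / ((r : ℝ) + 2)) *
          (Real.log n) ^ ((2 : ℝ) / ((r : ℝ) + 2))) := by
  exact FM.final hr

end
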